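/- Let X be a Polish, locally compact Hausdorff space, and let k : X × X → ℝ be a bounded continuous symmetric positive semidefinite kernel with 0 ≤ k(·,·) ≤ K for some K > 0, such that the MMD d_k is a metric on P(X) metrizing weak convergence. Let P, Q be Borel probability measures on X, let (m_k, n_k) → ∞ with m_k/(m_k+n_k) → c ∈ (0,1), let y_1,…,y_{m_k} be i.i.d. P and independently x_1,…,x_{n_k} i.i.d. Q, and assume 0 < D* < ∞ where D* := inf_{R ∈ P(X)} [ c·D(R‖P) + (1−c)·D(R‖Q) ]. Fix α ∈ (0,1) and set γ_{m,n} = (sqrt(K/m) + sqrt(K/n))·(2 + sqrt(2·log(2/α))). Then: (1) if Q = P, for all m, n, Prob(d_k(P̂_m, Q̂_n) > γ_{m,n}) ≤ α; and (2) if P ≠ Q, liminf_{k→∞} −(1/(m_k+n_k)) log Prob(d_k(P̂_{m_k}, Q̂_{n_k}) ≤ γ_{m_k,n_k}) = D*. -/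

import Mathlib

open MeasureTheory Filter Topology ENNReal
open scoped Classical

noncomputable section
/-- The Kullback-Leibler divergence `D(P‖Q) ∈ [0,∞]`: it equals `∫ log (dP/dQ) dP` when
`P ≪ Q` (and the integral is well defined), and `+∞` otherwise. -/
def klDiv {X : Type*} [MeasurableSpace X] (P Q : Measure X) : ℝ≥0∞ :=
  if P ≪ Q ∧ Integrable (llr P Q) P then ENNReal.ofReal (∫ x, llr P Q x ∂P) else ⊤
/-- The empirical measure `(1/n) ∑_{i<n} δ_{x i}` of a sample, as a probability measure
(junk value for `n = 0`). -/
def empMeas {X : Type*} [MeasurableSpace X] [Nonempty X] (n : ℕ) (x : Fin n → X) :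
    ProbabilityMeasure X :=
  if h : 0 < n then
    ⟨(n : ℝ≥0∞)⁻¹ • ∑ i, Measure.dirac (x i), by
      constructor
      simp only [Measure.smul_apply, smul_eq_mul, Measure.coe_finset_sum, Finset.sum_apply,
        measure_univ, Finset.sum_const, Finset.card_univ, Fintype.card_fin, nsmul_eq_mul, mul_one]
      exact ENNReal.inv_mul_cancel (by exact_mod_cast h.ne') (by simp)⟩
  else ⟨Measure.dirac (Classical.arbitrary X), inferInstance⟩
/-- The squared Maximum Mean Discrepancy associated with the kernel `k`. -/
def mmdSq {X : Type*} [MeasurableSpace X] (k : X → X → ℝ) (P Q : Measure X) : ℝ :=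
  (∫ y, ∫ y', k y y' ∂P ∂P) + (∫ x, ∫ x', k x x' ∂Q ∂Q) - 2 * ∫ y, ∫ x, k y x ∂Q ∂P

/-- The Maximum Mean Discrepancy `d_k`, the nonnegative square root of `mmdSq`. -/
def mmd {X : Type*} [MeasurableSpace X] (k : X → X → ℝ) (P Q : Measure X) : ℝ :=
  Real.sqrt (mmdSq k P Q)
/-- The exponential decay rate `-(1/n) log p` of a probability `p`, valued in `EReal`
(with `-(1/n) log 0 = ⊤`). -/
def expRate (n : ℕ) (p : ℝ≥0∞) : EReal := -((((n : ℝ)⁻¹ : ℝ) : EReal) * ENNReal.log p)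

/-- If `F(a, ·)` is sub-Gaussian around its mean for every `a` and the partial mean is sub-Gaussian,
then `F` is sub-Gaussian around its mean for the product measure. -/
lemma hasSubgaussianMGF_prod {A B : Type*} [MeasurableSpace A] [MeasurableSpace B]
    {μ : Measure A} {ν : Measure B} [IsProbabilityMeasure μ] [IsProbabilityMeasure ν]
    {F : A × B → ℝ} (hF : Measurable F) {M : ℝ} (hM : ∀ p, |F p| ≤ M) {c₁ c₂ : NNReal}
    (h₁ : ∀ a, ProbabilityTheory.HasSubgaussianMGF
      (fun b => F (a, b) - ∫ b', F (a, b') ∂ν) c₁ ν)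
    (h₂ : ProbabilityTheory.HasSubgaussianMGF
      (fun a => ∫ b, F (a, b) ∂ν - ∫ a', ∫ b, F (a', b) ∂ν ∂μ) c₂ μ) :
    ProbabilityTheory.HasSubgaussianMGF (fun p => F p - ∫ q, F q ∂(μ.prod ν)) (c₁ + c₂)
      (μ.prod ν) := by
  have hint : Integrable F (μ.prod ν) :=
    Integrable.of_bound hF.aestronglyMeasurable M (ae_of_all _ fun p => by simpa using hM p)
  have hexp : ∀ t : ℝ, Integrable (fun p => Real.exp (t * (F p - ∫ q, F q ∂(μ.prod ν))))
      (μ.prod ν) := fun t => by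
    refine ProbabilityTheory.integrable_exp_mul_of_mem_Icc (a := -M - ∫ q, F q ∂(μ.prod ν))
      (b := M - ∫ q, F q ∂(μ.prod ν)) (hF.sub_const _).aemeasurable (ae_of_all _ fun p => ?_)
    have := abs_le.1 (hM p)
    constructor <;> linarith
  refine ⟨hexp, fun t => ?_⟩
  have hmean : ∫ q, F q ∂(μ.prod ν) = ∫ a', ∫ b, F (a', b) ∂ν ∂μ := integral_prod _ hint
  rw [ProbabilityTheory.mgf, integral_prod _ (hexp t), hmean]
  set g : A → ℝ := fun a => ∫ b, F (a, b) ∂ν with hg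
  set e := ∫ a, g a ∂μ with he
  have key : ∀ a, ∫ b, Real.exp (t * (F (a, b) - e)) ∂ν
      ≤ Real.exp (c₁ * t ^ 2 / 2) * Real.exp (t * (g a - e)) := fun a => by
    have : ∀ b, Real.exp (t * (F (a, b) - e))
        = Real.exp (t * (F (a, b) - g a)) * Real.exp (t * (g a - e)) := fun b => by
      rw [← Real.exp_add]; ring_nf
    simp_rw [this]
    rw [integral_mul_const]
    exact mul_le_mul_of_nonneg_right ((h₁ a).mgf_le t) (Real.exp_pos _).le
  calc ∫ a, ∫ b, Real.exp (t * (F (a, b) - e)) ∂ν ∂μ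
      ≤ ∫ a, Real.exp (c₁ * t ^ 2 / 2) * Real.exp (t * (g a - e)) ∂μ := by
        refine integral_mono ?_ ((h₂.integrable_exp_mul t).const_mul _) key
        have := (hexp t).integral_prod_left
        rwa [hmean] at this
    _ ≤ Real.exp (c₁ * t ^ 2 / 2) * Real.exp (c₂ * t ^ 2 / 2) := by
        rw [integral_const_mul]
        exact mul_le_mul_of_nonneg_left (h₂.mgf_le t) (Real.exp_pos _).le
    _ = Real.exp (((c₁ + c₂ : NNReal) : ℝ) * t ^ 2 / 2) := by
        rw [← Real.exp_add]; push_cast; ring_nf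

/-- **Hoeffding's lemma** for a function whose oscillation is at most `c`. -/
lemma hasSubgaussianMGF_of_oscillation_le {A : Type*} [MeasurableSpace A] {μ : Measure A}
    [IsProbabilityMeasure μ] {g : A → ℝ} (hg : Measurable g) (c : NNReal)
    (hosc : ∀ a b, |g a - g b| ≤ c) :
    ProbabilityTheory.HasSubgaussianMGF (fun a => g a - ∫ a', g a' ∂μ) ((c / 2) ^ 2) μ := by
  obtain ⟨a₀⟩ : Nonempty A := μ.nonempty_of_neZero
  have hlow : ∀ a b, g b - c ≤ g a := fun a b => by linarith [(abs_le.1 (hosc b a)).2]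
  have hbdd : BddBelow (Set.range g) := ⟨g a₀ - c, by rintro _ ⟨a, rfl⟩; exact hlow a a₀⟩
  have hmem : ∀ a, g a ∈ Set.Icc (⨅ a, g a) ((⨅ a, g a) + c) := fun a => by
    have : Nonempty A := ⟨a₀⟩
    refine ⟨ciInf_le hbdd a, ?_⟩
    linarith [le_ciInf fun b => hlow b a]
  simpa using ProbabilityTheory.hasSubgaussianMGF_of_mem_Icc hg.aemeasurable
    (ae_of_all μ hmem)

/-- **McDiarmid's inequality**, in moment generating function form. -/
lemma hasSubgaussianMGF_pi_of_bounded_differences {A : Type*} [MeasurableSpace A] {μ : Measure A}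
    [IsProbabilityMeasure μ] (c : NNReal) {M : ℝ} (n : ℕ) {f : (Fin n → A) → ℝ}
    (hf : Measurable f) (hM : ∀ x, |f x| ≤ M)
    (hdiff : ∀ x i a, |f (Function.update x i a) - f x| ≤ c) :
    ProbabilityTheory.HasSubgaussianMGF
      (fun x => f x - ∫ x', f x' ∂(Measure.pi fun _ => μ)) (n * (c / 2) ^ 2)
      (Measure.pi fun _ : Fin n => μ) := by
  induction n with
  | zero =>
    have : (fun x => f x - ∫ x', f x' ∂(Measure.pi fun _ : Fin 0 => μ)) = fun _ => 0 := by
      funext x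
      rw [show f = fun _ => f x from funext fun y => congrArg f (Subsingleton.elim _ _)]
      simp
    rw [this]
    simp
  | succ n ih =>
    let F : A × (Fin n → A) → ℝ := fun p => f (Fin.cons p.1 p.2)
    have hcons : Measurable fun p : A × (Fin n → A) => (Fin.cons p.1 p.2 : Fin (n + 1) → A) :=
      measurable_pi_iff.2 fun i => by
        refine Fin.cases ?_ (fun j => ?_) i
        · simpa using measurable_fst
        · simpa [Function.comp_def] using (measurable_pi_apply j).comp measurable_snd
    have hF : Measurable F := hf.comp hcons
    have hpres : MeasurePreserving (MeasurableEquiv.piFinSuccAbove (fun _ : Fin (n + 1) => A) 0)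
        (Measure.pi fun _ : Fin (n + 1) => μ) (μ.prod (Measure.pi fun _ : Fin n => μ)) :=
      measurePreserving_piFinSuccAbove (fun _ : Fin (n + 1) => μ) 0
    have hFf : ∀ x, F (MeasurableEquiv.piFinSuccAbove (fun _ : Fin (n + 1) => A) 0 x) = f x :=
      fun x => by
        change f (Fin.cons (x 0) (fun j => x (Fin.succAbove 0 j))) = f x
        congr 1
        exact Fin.cons_self_tail x
    have hint : ∀ a, Integrable (fun b => F (a, b)) (Measure.pi fun _ : Fin n => μ) := fun a =>
      Integrable.of_bound (hF.comp measurable_prodMk_left).aestronglyMeasurable M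
        (ae_of_all _ fun p => by simpa using hM _)
    have h₁ := fun a : A => ih (f := fun b => F (a, b)) (hF.comp measurable_prodMk_left)
      (fun x => hM _) (fun x i b => by
        have := hdiff (Fin.cons a x) i.succ b
        rwa [← Fin.cons_update] at this)
    have h₂ := hasSubgaussianMGF_of_oscillation_le (μ := μ)
      (g := fun a => ∫ b, F (a, b) ∂(Measure.pi fun _ : Fin n => μ))
      hF.stronglyMeasurable.integral_prod_right'.measurable c (fun a b => by
        rw [← integral_sub (hint a) (hint b)]
        have := norm_integral_le_of_norm_le_const (μ := Measure.pi fun _ : Fin n => μ)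
          (f := fun x => F (a, x) - F (b, x)) (C := c) (ae_of_all _ fun x => by
            have := hdiff (Fin.cons b x) 0 a
            rwa [Fin.update_cons_zero] at this)
        simpa using this)
    have h := hasSubgaussianMGF_prod hF (fun p => hM _) h₁ h₂
    rw [← hpres.map_eq] at h
    have h' := h.of_map hpres.measurable.aemeasurable
    rw [hpres.map_eq, ← hpres.integral_comp'] at h'
    simp only [Function.comp_def, hFf] at h'
    convert h' using 1
    push_cast
    ring

section EmpiricalMeasure

variable {X : Type*} [MeasurableSpace X] [Nonempty X]

lemma coe_empMeas {n : ℕ} (hn : 0 < n) (x : Fin n → X) :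
    (empMeas n x : Measure X) = (n : ℝ≥0∞)⁻¹ • ∑ i, Measure.dirac (x i) := by
  simp [empMeas, hn]

lemma integral_empMeas [MeasurableSingletonClass X] {n : ℕ} (hn : 0 < n) (x : Fin n → X)
    (f : X → ℝ) : ∫ y, f y ∂(empMeas n x : Measure X) = (n : ℝ)⁻¹ * ∑ i, f (x i) := by
  rw [coe_empMeas hn, integral_smul_measure, integral_finsetSum_measure]
  · simp
  · exact fun i _ => integrable_dirac (by simp)

lemma mmdSq_empMeas [MeasurableSingletonClass X] (k : X → X → ℝ) {m n : ℕ} (hm : 0 < m)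
    (hn : 0 < n) (y : Fin m → X) (x : Fin n → X) :
    mmdSq k (empMeas m y : Measure X) (empMeas n x : Measure X)
      = (m : ℝ)⁻¹ ^ 2 * (∑ i, ∑ j, k (y i) (y j)) + (n : ℝ)⁻¹ ^ 2 * (∑ i, ∑ j, k (x i) (x j))
        - 2 * ((m : ℝ)⁻¹ * (n : ℝ)⁻¹ * ∑ i, ∑ j, k (y i) (x j)) := by
  simp only [mmdSq, integral_empMeas hm, integral_empMeas hn, ← Finset.mul_sum]
  ring

lemma mmdSq_empMeas_nonneg [MeasurableSingletonClass X] {k : X → X → ℝ}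
    (hk_symm : ∀ x y, k x y = k y x)
    (hk_psd : ∀ (N : ℕ) (z : Fin N → X) (c : Fin N → ℝ),
      0 ≤ ∑ i, ∑ j, c i * c j * k (z i) (z j))
    {m n : ℕ} (hm : 0 < m) (hn : 0 < n) (y : Fin m → X) (x : Fin n → X) :
    0 ≤ mmdSq k (empMeas m y : Measure X) (empMeas n x : Measure X) := by
  have h := hk_psd (m + n) (Fin.append y x)
    (Fin.append (fun _ => (m : ℝ)⁻¹) (fun _ => -(n : ℝ)⁻¹))
  simp only [Fin.sum_univ_add, Fin.append_left, Fin.append_right, Finset.sum_add_distrib,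
    ← Finset.mul_sum] at h
  have hswap : ∑ i, ∑ j, k (x i) (y j) = ∑ i, ∑ j, k (y i) (x j) := by
    rw [Finset.sum_comm]
    exact Finset.sum_congr rfl fun i _ => Finset.sum_congr rfl fun j _ => hk_symm _ _
  rw [hswap] at h
  rw [mmdSq_empMeas k hm hn]
  linarith

lemma mmd_empMeas_update_le [MeasurableSingletonClass X] {k : X → X → ℝ}
    (hk_symm : ∀ x y, k x y = k y x) {K : ℝ} (hk_bdd : ∀ x y, k x y ∈ Set.Icc (0 : ℝ) K)
    {m : ℕ} (hm : 0 < m) (y : Fin m → X) (i : Fin m) (a : X) :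
    mmd k (empMeas m (Function.update y i a) : Measure X) (empMeas m y : Measure X)
      ≤ Real.sqrt (2 * K) / m := by
  set y' := Function.update y i a with hy'
  have hswap : ∑ j, ∑ l, k (y' j) (y l) = ∑ j, ∑ l, k (y j) (y' l) := by
    rw [Finset.sum_comm]
    exact Finset.sum_congr rfl fun i _ => Finset.sum_congr rfl fun j _ => hk_symm _ _
  have hsum : mmdSq k (empMeas m y' : Measure X) (empMeas m y : Measure X)
      = (m : ℝ)⁻¹ ^ 2 * ∑ j, ∑ l, (k (y' j) (y' l) + k (y j) (y l) - k (y' j) (y l)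
        - k (y j) (y' l)) := by
    rw [mmdSq_empMeas k hm hm]
    simp only [Finset.sum_sub_distrib, Finset.sum_add_distrib]
    rw [hswap]
    ring
  have hne : ∀ j, j ≠ i → y' j = y j := fun j hj => Function.update_of_ne hj _ _
  rw [Finset.sum_eq_single i, Finset.sum_eq_single i] at hsum
  · rw [mmd, hsum]
    refine (Real.sqrt_le_sqrt (y := (m : ℝ)⁻¹ ^ 2 * (2 * K)) ?_).trans_eq ?_
    · refine mul_le_mul_of_nonneg_left ?_ (by positivity)
      linarith [(hk_bdd (y' i) (y' i)).2, (hk_bdd (y i) (y i)).2, (hk_bdd (y' i) (y i)).1,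
        (hk_bdd (y i) (y' i)).1]
    · rw [Real.sqrt_mul (by positivity), Real.sqrt_sq (by positivity)]
      ring
  · intro l _ hl
    rw [hne l hl]
    ring
  · simp
  · intro j _ hj
    rw [hne j hj]
    exact Finset.sum_eq_zero fun l _ => by ring
  · simp

end EmpiricalMeasure

section Level

variable {X : Type*} [MeasurableSpace X]

lemma mmdSq_comm {k : X → X → ℝ} (hk : Measurable fun p : X × X => k p.1 p.2)
    (hk_symm : ∀ x y, k x y = k y x) {K : ℝ} (hk_bdd : ∀ x y, k x y ∈ Set.Icc (0 : ℝ) K)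
    (P Q : Measure X) [IsProbabilityMeasure P] [IsProbabilityMeasure Q] :
    mmdSq k P Q = mmdSq k Q P := by
  have hint : Integrable (fun p : X × X => k p.1 p.2) (P.prod Q) :=
    Integrable.of_bound hk.aestronglyMeasurable K (ae_of_all _ fun p => by
      rw [Real.norm_eq_abs, abs_of_nonneg (hk_bdd _ _).1]; exact (hk_bdd _ _).2)
  have : ∫ y, ∫ x, k y x ∂Q ∂P = ∫ y, ∫ x, k y x ∂P ∂Q := by
    rw [integral_integral_swap hint]
    simp_rw [hk_symm]
  rw [mmdSq, mmdSq, this]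
  ring

lemma mmd_comm {k : X → X → ℝ} (hk : Measurable fun p : X × X => k p.1 p.2)
    (hk_symm : ∀ x y, k x y = k y x) {K : ℝ} (hk_bdd : ∀ x y, k x y ∈ Set.Icc (0 : ℝ) K)
    (P Q : Measure X) [IsProbabilityMeasure P] [IsProbabilityMeasure Q] :
    mmd k P Q = mmd k Q P := by
  rw [mmd, mmd, mmdSq_comm hk hk_symm hk_bdd]

lemma integral_sum_kernel_pi {k : X → X → ℝ} (hk : Measurable fun p : X × X => k p.1 p.2)
    {K : ℝ} (hk_bdd : ∀ x y, k x y ∈ Set.Icc (0 : ℝ) K) (P : Measure X)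
    [IsProbabilityMeasure P] (m : ℕ) :
    ∫ y : Fin m → X, ∑ i, ∑ j, k (y i) (y j) ∂(Measure.pi fun _ => P)
      ≤ m * K + (m ^ 2 - m) * ∫ x, ∫ y, k x y ∂P ∂P := by
  have hnorm : ∀ x y, ‖k x y‖ ≤ K := fun x y => by
    rw [Real.norm_eq_abs, abs_of_nonneg (hk_bdd _ _).1]; exact (hk_bdd _ _).2
  have hint : ∀ i j : Fin m, Integrable (fun y : Fin m → X => k (y i) (y j))
      (Measure.pi fun _ => P) := fun i j =>
    have hmeas : Measurable fun y : Fin m → X => k (y i) (y j) :=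
      hk.comp (g := fun p : X × X => k p.1 p.2)
        (f := fun y : Fin m → X => (y i, y j)) (by fun_prop)
    Integrable.of_bound hmeas.aestronglyMeasurable K (ae_of_all _ fun y => hnorm _ _)
  rw [integral_finsetSum _ fun i _ => integrable_finsetSum _ fun j _ => hint i j]
  set κ := ∫ x, ∫ y, k x y ∂P ∂P with hκ
  have hterm : ∀ i j : Fin m, ∫ y : Fin m → X, k (y i) (y j) ∂(Measure.pi fun _ => P)
      ≤ (if j = i then K - κ else 0) + κ := fun i j => by
    split_ifs with hij
    · refine (integral_mono (hint i j) (integrable_const K) fun y => (hk_bdd _ _).2).trans ?_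
      simp
    · have hmap := Measure.infinitePi_map_eval_prod (P := fun _ : Fin m => P) (Ne.symm hij)
      rw [Measure.infinitePi_eq_pi] at hmap
      have hkint : Integrable (fun p : X × X => k p.1 p.2) (P.prod P) :=
        Integrable.of_bound hk.aestronglyMeasurable K (ae_of_all _ fun p => hnorm _ _)
      have : κ = ∫ p, k p.1 p.2 ∂(P.prod P) := (integral_prod _ hkint).symm
      rw [zero_add, this, ← hmap, integral_map (by fun_prop) hk.aestronglyMeasurable]
  have hrow : ∀ i : Fin m, ∫ y : Fin m → X, ∑ j, k (y i) (y j) ∂(Measure.pi fun _ => P)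
      ≤ (K - κ) + m * κ := fun i => by
    rw [integral_finsetSum _ fun j _ => hint i j]
    refine (Finset.sum_le_sum fun j _ => hterm i j).trans_eq ?_
    simp [Finset.sum_add_distrib]
  refine (Finset.sum_le_sum fun i _ => hrow i).trans_eq ?_
  simp
  ring

lemma integral_sum_kernel_prod {k : X → X → ℝ} (hk : Measurable fun p : X × X => k p.1 p.2)
    {K : ℝ} (hk_bdd : ∀ x y, k x y ∈ Set.Icc (0 : ℝ) K) (P : Measure X)
    [IsProbabilityMeasure P] (m n : ℕ) :
    ∫ p : (Fin m → X) × (Fin n → X), ∑ i, ∑ j, k (p.1 i) (p.2 j)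
        ∂((Measure.pi fun _ => P).prod (Measure.pi fun _ => P))
      = m * n * ∫ x, ∫ y, k x y ∂P ∂P := by
  have hnorm : ∀ x y, ‖k x y‖ ≤ K := fun x y => by
    rw [Real.norm_eq_abs, abs_of_nonneg (hk_bdd _ _).1]; exact (hk_bdd _ _).2
  have hint : ∀ (i : Fin m) (j : Fin n), Integrable
      (fun p : (Fin m → X) × (Fin n → X) => k (p.1 i) (p.2 j))
      ((Measure.pi fun _ => P).prod (Measure.pi fun _ => P)) := fun i j =>
    have hmeas : Measurable fun p : (Fin m → X) × (Fin n → X) => k (p.1 i) (p.2 j) :=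
      hk.comp (g := fun p : X × X => k p.1 p.2)
        (f := fun p : (Fin m → X) × (Fin n → X) => (p.1 i, p.2 j)) (by fun_prop)
    Integrable.of_bound hmeas.aestronglyMeasurable K (ae_of_all _ fun y => hnorm _ _)
  have hkint : Integrable (fun p : X × X => k p.1 p.2) (P.prod P) :=
    Integrable.of_bound hk.aestronglyMeasurable K (ae_of_all _ fun p => hnorm _ _)
  have hterm : ∀ (i : Fin m) (j : Fin n), ∫ p : (Fin m → X) × (Fin n → X), k (p.1 i) (p.2 j)
      ∂((Measure.pi fun _ => P).prod (Measure.pi fun _ => P)) = ∫ x, ∫ y, k x y ∂P ∂P :=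
    fun i j => by
      have hpres := (measurePreserving_eval (fun _ : Fin m => P) i).prod
        (measurePreserving_eval (fun _ : Fin n => P) j)
      rw [← integral_prod (fun p : X × X => k p.1 p.2) hkint, ← hpres.map_eq,
        integral_map hpres.measurable.aemeasurable hk.aestronglyMeasurable]
      rfl
  rw [integral_finsetSum _ fun i _ => integrable_finsetSum _ fun j _ => hint i j]
  simp_rw [integral_finsetSum _ fun j _ => hint _ j, hterm]
  simp
  ring

end Level

section LevelBound

variable {X : Type*} [MeasurableSpace X] {k : X → X → ℝ} {K : ℝ}

lemma measurable_sum_kernel {A : Type*} [MeasurableSpace A]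
    (hk : Measurable fun p : X × X => k p.1 p.2) {m n : ℕ} {y : A → Fin m → X} {x : A → Fin n → X}
    (hy : Measurable y) (hx : Measurable x) :
    Measurable fun a => ∑ i, ∑ j, k (y a i) (x a j) := by
  refine Finset.measurable_sum _ fun i _ => Finset.measurable_sum _ fun j _ => ?_
  exact hk.comp (g := fun p : X × X => k p.1 p.2) (f := fun a => (y a i, x a j))
    (((measurable_pi_apply i).comp hy).prodMk ((measurable_pi_apply j).comp hx))

lemma integral_integral_kernel_mem_Icc (hk_bdd : ∀ x y, k x y ∈ Set.Icc (0 : ℝ) K)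
    (P Q : Measure X) [IsProbabilityMeasure P] [IsProbabilityMeasure Q] :
    ∫ y, ∫ x, k y x ∂Q ∂P ∈ Set.Icc (0 : ℝ) K := by
  refine ⟨integral_nonneg fun y => integral_nonneg fun x => (hk_bdd y x).1, ?_⟩
  refine (le_abs_self _).trans ?_
  have hinner : ∀ y, ‖∫ x, k y x ∂Q‖ ≤ K := fun y => by
    simpa using norm_integral_le_of_norm_le_const (μ := Q) (f := fun x => k y x) (C := K)
      (ae_of_all _ fun x => by
        rw [Real.norm_eq_abs, abs_of_nonneg (hk_bdd _ _).1]; exact (hk_bdd _ _).2)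
  simpa using norm_integral_le_of_norm_le_const (μ := P) (ae_of_all _ hinner)

lemma abs_mmd_le (hk_bdd : ∀ x y, k x y ∈ Set.Icc (0 : ℝ) K) (P Q : Measure X)
    [IsProbabilityMeasure P] [IsProbabilityMeasure Q] : |mmd k P Q| ≤ Real.sqrt (2 * K) := by
  rw [mmd, abs_of_nonneg (Real.sqrt_nonneg _)]
  refine Real.sqrt_le_sqrt ?_
  rw [mmdSq]
  linarith [(integral_integral_kernel_mem_Icc hk_bdd P P).2,
    (integral_integral_kernel_mem_Icc hk_bdd Q Q).2,
      (integral_integral_kernel_mem_Icc hk_bdd P Q).1]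

variable [MeasurableSingletonClass X] [Nonempty X]

lemma measurable_mmd_empMeas (hk : Measurable fun p : X × X => k p.1 p.2) {m n : ℕ} (hm : 0 < m)
    (hn : 0 < n) : Measurable fun p : (Fin m → X) × (Fin n → X) =>
      mmd k (empMeas m p.1 : Measure X) (empMeas n p.2 : Measure X) := by
  simp only [mmd, mmdSq_empMeas k hm hn]
  have h₁ := measurable_sum_kernel hk (measurable_fst (α := Fin m → X) (β := Fin n → X))
    measurable_fst
  have h₂ := measurable_sum_kernel hk (measurable_snd (α := Fin m → X) (β := Fin n → X))
    measurable_snd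
  have h₃ := measurable_sum_kernel hk (measurable_fst (α := Fin m → X) (β := Fin n → X))
    measurable_snd
  fun_prop

lemma integral_mmdSq_empMeas_le (hk : Measurable fun p : X × X => k p.1 p.2)
    (hk_bdd : ∀ x y, k x y ∈ Set.Icc (0 : ℝ) K) (P : Measure X) [IsProbabilityMeasure P]
    {m n : ℕ} (hm : 0 < m) (hn : 0 < n) :
    ∫ p : (Fin m → X) × (Fin n → X), mmdSq k (empMeas m p.1 : Measure X) (empMeas n p.2 : Measure X)
        ∂((Measure.pi fun _ => P).prod (Measure.pi fun _ => P)) ≤ K / m + K / n := by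
  have hbdd : ∀ {a b : ℕ} (y : Fin a → X) (x : Fin b → X),
      ‖∑ i, ∑ j, k (y i) (x j)‖ ≤ a * b * K := fun {a b} y x => by
    rw [Real.norm_eq_abs, abs_of_nonneg (Finset.sum_nonneg fun i _ => Finset.sum_nonneg fun j _ =>
      (hk_bdd _ _).1)]
    refine (Finset.sum_le_sum fun i _ => Finset.sum_le_sum fun j _ => (hk_bdd _ _).2).trans_eq ?_
    simp [mul_assoc]
  set μ := (Measure.pi fun _ : Fin m => P).prod (Measure.pi fun _ : Fin n => P) with hμ
  have h₁ : Integrable (fun p : (Fin m → X) × (Fin n → X) => ∑ i, ∑ j, k (p.1 i) (p.1 j)) μ :=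
    Integrable.of_bound (measurable_sum_kernel hk measurable_fst
      measurable_fst).aestronglyMeasurable
      _ (ae_of_all _ fun p => hbdd _ _)
  have h₂ : Integrable (fun p : (Fin m → X) × (Fin n → X) => ∑ i, ∑ j, k (p.2 i) (p.2 j)) μ :=
    Integrable.of_bound (measurable_sum_kernel hk measurable_snd
      measurable_snd).aestronglyMeasurable
      _ (ae_of_all _ fun p => hbdd _ _)
  have h₃ : Integrable (fun p : (Fin m → X) × (Fin n → X) => ∑ i, ∑ j, k (p.1 i) (p.2 j)) μ :=
    Integrable.of_bound (measurable_sum_kernel hk measurable_fst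
      measurable_snd).aestronglyMeasurable
      _ (ae_of_all _ fun p => hbdd _ _)
  have e₁ : ∫ p, ∑ i, ∑ j, k (p.1 i) (p.1 j) ∂μ
      = ∫ y : Fin m → X, ∑ i, ∑ j, k (y i) (y j) ∂(Measure.pi fun _ => P) := by
    rw [hμ, integral_fun_fst (fun y : Fin m → X => ∑ i, ∑ j, k (y i) (y j))]
    simp
  have e₂ : ∫ p, ∑ i, ∑ j, k (p.2 i) (p.2 j) ∂μ
      = ∫ y : Fin n → X, ∑ i, ∑ j, k (y i) (y j) ∂(Measure.pi fun _ => P) := by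
    rw [hμ, integral_fun_snd (fun y : Fin n → X => ∑ i, ∑ j, k (y i) (y j))]
    simp
  have e₃ := integral_sum_kernel_prod hk hk_bdd P m n
  rw [← hμ] at e₃
  have b₁ := integral_sum_kernel_pi hk hk_bdd P m
  have b₂ := integral_sum_kernel_pi hk hk_bdd P n
  rw [← e₁] at b₁
  rw [← e₂] at b₂
  simp only [mmdSq_empMeas k hm hn]
  have h₁₂ : Integrable (fun p : (Fin m → X) × (Fin n → X) =>
      (m : ℝ)⁻¹ ^ 2 * (∑ i, ∑ j, k (p.1 i) (p.1 j))
        + (n : ℝ)⁻¹ ^ 2 * (∑ i, ∑ j, k (p.2 i) (p.2 j))) μ :=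
    (h₁.const_mul _).add (h₂.const_mul _)
  rw [integral_sub h₁₂ ((h₃.const_mul _).const_mul _),
    integral_add (h₁.const_mul _) (h₂.const_mul _)]
  simp only [integral_const_mul]
  rw [e₃]
  have hκ := (integral_integral_kernel_mem_Icc hk_bdd P P).1
  set κ := ∫ x, ∫ y, k x y ∂P ∂P
  have hm' : (0 : ℝ) < m := by exact_mod_cast hm
  have hn' : (0 : ℝ) < n := by exact_mod_cast hn
  calc _ ≤ (m : ℝ)⁻¹ ^ 2 * (m * K + (m ^ 2 - m) * κ) + (n : ℝ)⁻¹ ^ 2 * (n * K + (n ^ 2 - n) * κ)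
        - 2 * ((m : ℝ)⁻¹ * (n : ℝ)⁻¹ * (m * n * κ)) := by gcongr
    _ = K / m + K / n - (κ / m + κ / n) := by field_simp; ring
    _ ≤ K / m + K / n := by
      have : 0 ≤ κ / m + κ / n := by positivity
      linarith

lemma integral_mmd_empMeas_le (hk : Measurable fun p : X × X => k p.1 p.2)
    (hk_symm : ∀ x y, k x y = k y x)
    (hk_psd : ∀ (N : ℕ) (z : Fin N → X) (c : Fin N → ℝ),
      0 ≤ ∑ i, ∑ j, c i * c j * k (z i) (z j))
    (hK : 0 ≤ K) (hk_bdd : ∀ x y, k x y ∈ Set.Icc (0 : ℝ) K) (P : Measure X)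
    [IsProbabilityMeasure P] {m n : ℕ} (hm : 0 < m) (hn : 0 < n) :
    ∫ p : (Fin m → X) × (Fin n → X), mmd k (empMeas m p.1 : Measure X) (empMeas n p.2 : Measure X)
        ∂((Measure.pi fun _ => P).prod (Measure.pi fun _ => P))
      ≤ Real.sqrt (K / m) + Real.sqrt (K / n) := by
  set μ := (Measure.pi fun _ : Fin m => P).prod (Measure.pi fun _ : Fin n => P)
  set V := fun p : (Fin m → X) × (Fin n → X) =>
    mmd k (empMeas m p.1 : Measure X) (empMeas n p.2 : Measure X) with hV
  have hVm : MemLp V 2 μ := MemLp.of_bound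
    (measurable_mmd_empMeas hk hm hn).aestronglyMeasurable (Real.sqrt (2 * K))
    (ae_of_all _ fun p => abs_mmd_le hk_bdd _ _)
  have hvar := ProbabilityTheory.variance_nonneg V μ
  rw [ProbabilityTheory.variance_eq_sub hVm] at hvar
  have hsq : ∫ p, (V ^ 2) p ∂μ ≤ K / m + K / n := by
    refine Eq.trans_le (integral_congr_ae (ae_of_all _ fun p => ?_))
      (integral_mmdSq_empMeas_le hk hk_bdd P hm hn)
    exact Real.sq_sqrt (mmdSq_empMeas_nonneg hk_symm hk_psd hm hn _ _)
  refine abs_le_of_sq_le_sq' ?_ (by positivity) |>.2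
  have := Real.sq_sqrt (show 0 ≤ K / m by positivity)
  have := Real.sq_sqrt (show 0 ≤ K / n by positivity)
  nlinarith [mul_nonneg (Real.sqrt_nonneg (K / m)) (Real.sqrt_nonneg (K / n))]

lemma hasSubgaussianMGF_mmd_empMeas (hk : Measurable fun p : X × X => k p.1 p.2)
    (hk_symm : ∀ x y, k x y = k y x) (hk_bdd : ∀ x y, k x y ∈ Set.Icc (0 : ℝ) K)
    (h_tri : ∀ R S T : ProbabilityMeasure X,
      mmd k (R : Measure X) (T : Measure X)
        ≤ mmd k (R : Measure X) (S : Measure X) + mmd k (S : Measure X) (T : Measure X))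
    (P : Measure X) [IsProbabilityMeasure P] {m n : ℕ} (hm : 0 < m) (hn : 0 < n) :
    ProbabilityTheory.HasSubgaussianMGF
      (fun p : (Fin m → X) × (Fin n → X) =>
        mmd k (empMeas m p.1 : Measure X) (empMeas n p.2 : Measure X)
          - ∫ q : (Fin m → X) × (Fin n → X),
            mmd k (empMeas m q.1 : Measure X) (empMeas n q.2 : Measure X)
            ∂((Measure.pi fun _ => P).prod (Measure.pi fun _ => P)))
      (n * ((Real.sqrt (2 * K) / n).toNNReal / 2) ^ 2
        + m * ((Real.sqrt (2 * K) / m).toNNReal / 2) ^ 2)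
      ((Measure.pi fun _ => P).prod (Measure.pi fun _ => P)) := by
  have hV := measurable_mmd_empMeas hk hm hn
  have hM : ∀ p : (Fin m → X) × (Fin n → X), |mmd k (empMeas m p.1 : Measure X)
      (empMeas n p.2 : Measure X)| ≤ Real.sqrt (2 * K) := fun p => abs_mmd_le hk_bdd _ _
  have hfst : ∀ (y : Fin m → X) i a (x : Fin n → X),
      |mmd k (empMeas m (Function.update y i a) : Measure X) (empMeas n x : Measure X)
        - mmd k (empMeas m y : Measure X) (empMeas n x : Measure X)|
      ≤ (Real.sqrt (2 * K) / m).toNNReal := fun y i a x => by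
    rw [Real.coe_toNNReal _ (by positivity)]
    have hu := mmd_empMeas_update_le hk_symm hk_bdd hm y i a
    have h₁ := h_tri (empMeas m (Function.update y i a)) (empMeas m y) (empMeas n x)
    have h₂ := h_tri (empMeas m y) (empMeas m (Function.update y i a)) (empMeas n x)
    rw [mmd_comm hk hk_symm hk_bdd (empMeas m y : Measure X)
      (empMeas m (Function.update y i a) : Measure X)] at h₂
    rw [abs_le]
    constructor <;> linarith
  have hsnd : ∀ (y : Fin m → X) (x : Fin n → X) i a,
      |mmd k (empMeas m y : Measure X) (empMeas n (Function.update x i a) : Measure X)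
        - mmd k (empMeas m y : Measure X) (empMeas n x : Measure X)|
      ≤ (Real.sqrt (2 * K) / n).toNNReal := fun y x i a => by
    rw [Real.coe_toNNReal _ (by positivity)]
    have hu := mmd_empMeas_update_le hk_symm hk_bdd hn x i a
    have h₁ := h_tri (empMeas m y) (empMeas n x) (empMeas n (Function.update x i a))
    have h₂ := h_tri (empMeas m y) (empMeas n (Function.update x i a)) (empMeas n x)
    rw [mmd_comm hk hk_symm hk_bdd (empMeas n x : Measure X)
      (empMeas n (Function.update x i a) : Measure X)] at h₁
    rw [abs_le]
    constructor <;> linarith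
  refine hasSubgaussianMGF_prod hV hM (fun y => ?_) ?_
  · exact hasSubgaussianMGF_pi_of_bounded_differences _ n (hV.comp measurable_prodMk_left)
      (fun x => hM (y, x)) (hsnd y)
  · have hint : ∀ y : Fin m → X, Integrable (fun x : Fin n → X =>
        mmd k (empMeas m y : Measure X) (empMeas n x : Measure X)) (Measure.pi fun _ => P) :=
      fun y => Integrable.of_bound (hV.comp measurable_prodMk_left).aestronglyMeasurable _
        (ae_of_all _ fun x => hM (y, x))
    refine hasSubgaussianMGF_pi_of_bounded_differences (M := Real.sqrt (2 * K)) _ m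
      (hV.stronglyMeasurable.integral_prod_right).measurable (fun y => ?_) fun y i a => ?_
    · simpa using norm_integral_le_of_norm_le_const
        (μ := Measure.pi fun _ : Fin n => P)
        (f := fun x => mmd k (empMeas m y : Measure X) (empMeas n x : Measure X))
        (ae_of_all _ fun x => hM (y, x))
    · simp only
      rw [← integral_sub (hint _) (hint _)]
      simpa using norm_integral_le_of_norm_le_const
        (μ := Measure.pi fun _ : Fin n => P)
        (f := fun x => mmd k (empMeas m (Function.update y i a) : Measure X)
          (empMeas n x : Measure X) - mmd k (empMeas m y : Measure X) (empMeas n x : Measure X))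
        (ae_of_all _ fun x => hfst y i a x)

lemma measure_mmd_empMeas_gt_le (hk : Measurable fun p : X × X => k p.1 p.2)
    (hk_symm : ∀ x y, k x y = k y x)
    (hk_psd : ∀ (N : ℕ) (z : Fin N → X) (c : Fin N → ℝ),
      0 ≤ ∑ i, ∑ j, c i * c j * k (z i) (z j))
    (hK : 0 < K) (hk_bdd : ∀ x y, k x y ∈ Set.Icc (0 : ℝ) K)
    (h_tri : ∀ R S T : ProbabilityMeasure X,
      mmd k (R : Measure X) (T : Measure X)
        ≤ mmd k (R : Measure X) (S : Measure X) + mmd k (S : Measure X) (T : Measure X))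
    (P : Measure X) [IsProbabilityMeasure P] {α : ℝ} (hα0 : 0 < α) (hα1 : α < 1)
    {m n : ℕ} (hm : 0 < m) (hn : 0 < n) :
    ((Measure.pi fun _ => P).prod (Measure.pi fun _ => P))
      {p : (Fin m → X) × (Fin n → X) | (Real.sqrt (K / m) + Real.sqrt (K / n)) *
        (2 + Real.sqrt (2 * Real.log (2 / α)))
          < mmd k (empMeas m p.1 : Measure X) (empMeas n p.2 : Measure X)} ≤ ENNReal.ofReal α := by
  have hm' : (0 : ℝ) < m := by exact_mod_cast hm
  have hn' : (0 : ℝ) < n := by exact_mod_cast hn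
  have hlog : 0 < Real.log (2 / α) := Real.log_pos (by rw [lt_div_iff₀ hα0]; linarith)
  have hsub := hasSubgaussianMGF_mmd_empMeas hk hk_symm hk_bdd h_tri P hm hn
  have hE := integral_mmd_empMeas_le hk hk_symm hk_psd hK.le hk_bdd P hm hn
  set a := Real.sqrt (K / m) + Real.sqrt (K / n) with ha
  have ha0 : 0 < a := by positivity
  have hasq : K / m + K / n ≤ a ^ 2 := by
    have := Real.sq_sqrt (show 0 ≤ K / m by positivity)
    have := Real.sq_sqrt (show 0 ≤ K / n by positivity)
    nlinarith [mul_nonneg (Real.sqrt_nonneg (K / m)) (Real.sqrt_nonneg (K / n))]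
  set ε := a * Real.sqrt (2 * Real.log (2 / α)) with hε
  have hσ : ((n * ((Real.sqrt (2 * K) / n).toNNReal / 2) ^ 2
        + m * ((Real.sqrt (2 * K) / m).toNNReal / 2) ^ 2 : NNReal) : ℝ)
      = (K / m + K / n) / 2 := by
    push_cast
    rw [Real.coe_toNNReal _ (by positivity), Real.coe_toNNReal _ (by positivity)]
    simp only [div_pow, Real.sq_sqrt (show 0 ≤ 2 * K by positivity)]
    field_simp
    ring
  have htail := hsub.measure_ge_le (ε := ε) (by positivity)
  rw [hσ] at htail
  refine (measure_mono fun p hp => ?_).trans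
    ((ENNReal.le_ofReal_iff_toReal_le (measure_ne_top _ _) hα0.le).2 (htail.trans ?_))
  · simp only [Set.mem_ofPred_eq] at hp ⊢
    nlinarith
  · rw [← Real.le_log_iff_exp_le hα0]
    have hε2 : ε ^ 2 = a ^ 2 * (2 * Real.log (2 / α)) := by
      rw [hε, mul_pow, Real.sq_sqrt (by positivity)]
    have h2 : Real.log (2 / α) = Real.log 2 - Real.log α := Real.log_div (by norm_num) hα0.ne'
    have hlog2 : 0 < Real.log 2 := Real.log_pos (by norm_num)
    have hlogα : Real.log α < 0 := Real.log_neg hα0 hα1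
    rw [hε2, mul_div_cancel₀ _ two_ne_zero, div_le_iff₀ (by positivity)]
    nlinarith [mul_le_mul_of_nonneg_right hasq hlog.le, mul_pos hlog (pow_pos ha0 2)]

end LevelBound

section ExpRate

lemma log_ofReal_exp (x : ℝ) : ENNReal.log (ENNReal.ofReal (Real.exp x)) = x := by
  rw [ENNReal.log_ofReal_of_pos (Real.exp_pos x), Real.log_exp]

lemma inv_mul_coe_neg_mul {N : ℕ} (hN : 0 < N) (b : ℝ) :
    (((N : ℝ)⁻¹ : ℝ) : EReal) * ((-(N * b) : ℝ) : EReal) = -(b : EReal) := by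
  have : (N : ℝ) ≠ 0 := by positivity
  rw [← EReal.coe_mul, ← EReal.coe_neg]
  congr 1
  field_simp

lemma expRate_le {N : ℕ} (hN : 0 < N) {b : ℝ} {p : ℝ≥0∞}
    (h : ENNReal.ofReal (Real.exp (-(N * b))) ≤ p) : expRate N p ≤ b := by
  rw [expRate, EReal.neg_le, ← inv_mul_coe_neg_mul hN]
  exact mul_le_mul_of_nonneg_left (log_ofReal_exp (-(N * b)) ▸ ENNReal.log_monotone h)
    (EReal.coe_nonneg.2 (inv_nonneg.2 N.cast_nonneg))

lemma le_expRate {N : ℕ} (hN : 0 < N) {a : ℝ} {p : ℝ≥0∞}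
    (h : p ≤ ENNReal.ofReal (Real.exp (-(N * a)))) : a ≤ expRate N p := by
  rw [expRate, EReal.le_neg, ← inv_mul_coe_neg_mul hN]
  exact mul_le_mul_of_nonneg_left (log_ofReal_exp (-(N * a)) ▸ ENNReal.log_monotone h)
    (EReal.coe_nonneg.2 (inv_nonneg.2 N.cast_nonneg))

end ExpRate

section ChangeOfMeasure

variable {X : Type*} [MeasurableSpace X]

lemma lintegral_pi_prod (P : Measure X) [IsProbabilityMeasure P] {m : ℕ} {f : Fin m → X → ℝ≥0∞}
    (hf : ∀ i, Measurable (f i)) :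
    ∫⁻ y, ∏ i, f i (y i) ∂(Measure.pi fun _ : Fin m => P) = ∏ i, ∫⁻ x, f i x ∂P := by
  have hindep := ProbabilityTheory.iIndepFun_pi (μ := fun _ : Fin m => P) (X := f)
    fun i => (hf i).aemeasurable
  rw [ProbabilityTheory.lintegral_prod_eq_prod_lintegral_of_indepFun Finset.univ
    (fun i (y : Fin m → X) => f i (y i)) hindep fun i => (hf i).comp (measurable_pi_apply i)]
  exact Finset.prod_congr rfl fun i _ =>
    (measurePreserving_eval (fun _ : Fin m => P) i).lintegral_comp (hf i)

lemma pi_withDensity (P : Measure X) [IsProbabilityMeasure P] {ρ : X → ℝ≥0∞} (hρ : Measurable ρ)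
    [IsProbabilityMeasure (P.withDensity ρ)] (m : ℕ) :
    (Measure.pi fun _ : Fin m => P.withDensity ρ)
      = (Measure.pi fun _ : Fin m => P).withDensity fun y => ∏ i, ρ (y i) := by
  refine Measure.pi_eq (μ := fun _ : Fin m => P.withDensity ρ) fun s hs => ?_
  rw [withDensity_apply _ (MeasurableSet.univ_pi hs),
    ← lintegral_indicator (MeasurableSet.univ_pi hs)]
  simp only [withDensity_apply _ (hs _), ← lintegral_indicator (hs _)]
  rw [← lintegral_pi_prod P fun i => hρ.indicator (hs i)]
  refine lintegral_congr fun y => ?_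
  by_cases hy : y ∈ Set.univ.pi s
  · rw [Set.indicator_of_mem hy]
    exact Finset.prod_congr rfl fun i _ => (Set.indicator_of_mem (hy i trivial) _).symm
  · rw [Set.indicator_of_notMem hy]
    obtain ⟨i, hi⟩ : ∃ i, y i ∉ s i := by simpa using hy
    exact (Finset.prod_eq_zero (Finset.mem_univ i) (Set.indicator_of_notMem hi _)).symm

lemma withDensity_ofReal_toReal_rnDeriv {R P : Measure X} [IsProbabilityMeasure R]
    [IsProbabilityMeasure P] (hRP : R ≪ P) :
    P.withDensity (fun x => ENNReal.ofReal (R.rnDeriv P x).toReal) = R := by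
  conv_rhs => rw [← Measure.withDensity_rnDeriv_eq R P hRP]
  refine withDensity_congr_ae ?_
  filter_upwards [R.rnDeriv_lt_top P] with x hx
  exact ENNReal.ofReal_toReal hx.ne

lemma prod_ofReal_rnDeriv_le (R P : Measure X) {m : ℕ} (y : Fin m → X) :
    ∏ i, ENNReal.ofReal (R.rnDeriv P (y i)).toReal
      ≤ ENNReal.ofReal (Real.exp (∑ i, llr R P (y i))) := by
  rw [Real.exp_sum, ENNReal.ofReal_prod_of_nonneg fun i _ => (Real.exp_pos _).le]
  exact Finset.prod_le_prod' fun i _ => ENNReal.ofReal_le_ofReal (Real.le_exp_log _)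

lemma measure_inter_llr_le {R P Q : Measure X} [IsProbabilityMeasure R] [IsProbabilityMeasure P]
    [IsProbabilityMeasure Q] (hRP : R ≪ P) (hRQ : R ≪ Q) {m n : ℕ}
    {A : Set ((Fin m → X) × (Fin n → X))} (hA : MeasurableSet A) (T₁ T₂ : ℝ) :
    ((Measure.pi fun _ => R).prod (Measure.pi fun _ => R))
      (A ∩ {p | ∑ i, llr R P (p.1 i) ≤ T₁ ∧ ∑ j, llr R Q (p.2 j) ≤ T₂})
      ≤ ENNReal.ofReal (Real.exp (T₁ + T₂))
        * ((Measure.pi fun _ => P).prod (Measure.pi fun _ => Q)) A := by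
  set ρ := fun x => ENNReal.ofReal (R.rnDeriv P x).toReal with hρ
  set σ := fun x => ENNReal.ofReal (R.rnDeriv Q x).toReal with hσ
  have hρm : Measurable ρ := (Measure.measurable_rnDeriv R P).ennreal_toReal.ennreal_ofReal
  have hσm : Measurable σ := (Measure.measurable_rnDeriv R Q).ennreal_toReal.ennreal_ofReal
  have hR₁ := withDensity_ofReal_toReal_rnDeriv hRP
  have hR₂ := withDensity_ofReal_toReal_rnDeriv hRQ
  have : IsProbabilityMeasure (P.withDensity ρ) := hR₁ ▸ inferInstance
  have : IsProbabilityMeasure (Q.withDensity σ) := hR₂ ▸ inferInstance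
  have h₁ := pi_withDensity P hρm m
  have h₂ := pi_withDensity Q hσm n
  rw [hR₁] at h₁
  rw [hR₂] at h₂
  have hllr₁ : Measurable fun p : (Fin m → X) × (Fin n → X) => ∑ i, llr R P (p.1 i) :=
    Finset.measurable_sum _ fun i _ =>
      (measurable_llr R P).comp ((measurable_pi_apply i).comp measurable_fst)
  have hllr₂ : Measurable fun p : (Fin m → X) × (Fin n → X) => ∑ j, llr R Q (p.2 j) :=
    Finset.measurable_sum _ fun j _ =>
      (measurable_llr R Q).comp ((measurable_pi_apply j).comp measurable_snd)
  have hB : MeasurableSet (A ∩ {p : (Fin m → X) × (Fin n → X) |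
      ∑ i, llr R P (p.1 i) ≤ T₁ ∧ ∑ j, llr R Q (p.2 j) ≤ T₂}) :=
    hA.inter ((measurableSet_le hllr₁ measurable_const).inter
      (measurableSet_le hllr₂ measurable_const))
  conv_lhs => rw [h₁, h₂, prod_withDensity (by fun_prop) (by fun_prop)]
  rw [withDensity_apply _ hB]
  refine (setLIntegral_mono measurable_const (g := fun _ => ENNReal.ofReal (Real.exp (T₁ + T₂)))
    fun p hp => ?_).trans ?_
  · rw [Real.exp_add, ENNReal.ofReal_mul (Real.exp_pos _).le]
    exact mul_le_mul'
      ((prod_ofReal_rnDeriv_le R P p.1).trans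
        (ENNReal.ofReal_le_ofReal (Real.exp_le_exp.2 hp.2.1)))
      ((prod_ofReal_rnDeriv_le R Q p.2).trans
        (ENNReal.ofReal_le_ofReal (Real.exp_le_exp.2 hp.2.2)))
  · rw [setLIntegral_const]
    gcongr
    exact Set.inter_subset_left

lemma tendsto_measure_pi_sum_gt (P : Measure X) [IsProbabilityMeasure P] {f : X → ℝ}
    (hfm : Measurable f) (hf : Integrable f P) {b : ℝ} (hb : (∫ x, f x ∂P) < b) :
    Tendsto (fun m : ℕ => (Measure.pi fun _ : Fin m => P) {y | m * b < ∑ i, f (y i)})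
      atTop (𝓝 0) := by
  set μ := Measure.infinitePi fun _ : ℕ => P with hμ
  have heval : ∀ i : ℕ, MeasurePreserving (fun ω : ℕ → X => ω i) μ P := fun i =>
    measurePreserving_eval_infinitePi _ i
  have hslln := ProbabilityTheory.strong_law_ae_real (μ := μ) (fun i ω => f (ω i))
    ((heval 0).integrable_comp_of_integrable hf)
    (fun i j hij => (ProbabilityTheory.iIndepFun_infinitePi (P := fun _ : ℕ => P)
      (X := fun _ => f) fun _ => hfm).indepFun hij)
    (fun i => ⟨(hfm.comp (measurable_pi_apply i)).aemeasurable,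
      (hfm.comp (measurable_pi_apply 0)).aemeasurable, by
        rw [← Function.comp_def f, ← Function.comp_def f,
          ← Measure.map_map hfm (measurable_pi_apply i),
          ← Measure.map_map hfm (measurable_pi_apply 0), (heval i).map_eq, (heval 0).map_eq]⟩)
  have hmean : ∫ ω, f (ω 0) ∂μ = ∫ x, f x ∂P := by
    rw [← (heval 0).map_eq, integral_map (heval 0).aemeasurable hfm.aestronglyMeasurable]
  rw [hmean] at hslln
  have htm := tendstoInMeasure_of_tendsto_ae (μ := μ)
    (f := fun (m : ℕ) ω => (∑ i ∈ Finset.range m, f (ω i)) / m) (g := fun _ => ∫ x, f x ∂P)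
    (fun m => ((Finset.measurable_sum _ fun i _ =>
      hfm.comp (measurable_pi_apply i)).div_const _).aestronglyMeasurable) hslln
  rw [tendstoInMeasure_iff_dist] at htm
  refine tendsto_of_tendsto_of_tendsto_of_le_of_le' tendsto_const_nhds
    (htm (b - ∫ x, f x ∂P) (sub_pos.2 hb)) (Eventually.of_forall fun _ => zero_le) ?_
  filter_upwards [eventually_gt_atTop 0] with m hm
  have hmap : μ.map (fun ω (i : Fin m) => ω i) = Measure.pi fun _ : Fin m => P := by
    rw [hμ, Measure.map_infinitePi_infinitePi_of_inj (P := fun _ : ℕ => P)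
      (f := fun i : Fin m => (i : ℕ)) Fin.val_injective, Measure.infinitePi_eq_pi]
  have hset : MeasurableSet {y : Fin m → X | m * b < ∑ i, f (y i)} :=
    measurableSet_lt measurable_const
      (Finset.measurable_sum _ fun i _ => hfm.comp (measurable_pi_apply i))
  rw [← hmap, Measure.map_apply (by fun_prop) hset]
  refine measure_mono fun ω hω => ?_
  simp only [Set.mem_preimage, Set.mem_ofPred_eq] at hω ⊢
  rw [Fin.sum_univ_eq_sum_range (fun i => f (ω i))] at hω
  have hm' : (0 : ℝ) < m := by exact_mod_cast hm
  rw [Real.dist_eq]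
  refine le_trans ?_ (le_abs_self _)
  have : b < (∑ i ∈ Finset.range m, f (ω i)) / m := by
    rw [lt_div_iff₀ hm']
    linarith
  linarith

end ChangeOfMeasure

section LowerBound

variable {X : Type*} [MeasurableSpace X]

lemma tendsto_add_mul_atBot {m n : ℕ → ℕ} (hm : Tendsto m atTop atTop) {c : ℝ}
    (hc : Tendsto (fun j : ℕ => (m j : ℝ) / (m j + n j)) atTop (𝓝 c)) {a₁ a₂ b : ℝ}
    (hb : c * a₁ + (1 - c) * a₂ < b) :
    Tendsto (fun j => m j * a₁ + n j * a₂ - ((m j + n j : ℕ) : ℝ) * b) atTop atBot := by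
  have hN : Tendsto (fun j => ((m j + n j : ℕ) : ℝ)) atTop atTop :=
    tendsto_natCast_atTop_atTop.comp (tendsto_atTop_mono (fun j => Nat.le_add_right _ _) hm)
  have hlim : Tendsto (fun j => (m j : ℝ) / (m j + n j) * a₁ + (1 - (m j : ℝ) / (m j + n j)) * a₂
      - b) atTop (𝓝 (c * a₁ + (1 - c) * a₂ - b)) :=
    ((hc.mul_const _).add ((hc.const_sub 1).mul_const _)).sub_const _
  refine (hN.atTop_mul_neg (sub_neg.2 hb) hlim).congr' ?_
  filter_upwards [hm.eventually_gt_atTop 0] with j hj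
  have : (m j + n j : ℝ) ≠ 0 := by positivity
  push_cast
  field_simp
  ring

lemma eventually_expRate_le {R P Q : Measure X} [IsProbabilityMeasure R] [IsProbabilityMeasure P]
    [IsProbabilityMeasure Q] (hRP : R ≪ P) (hRQ : R ≪ Q) (hP : Integrable (llr R P) R)
    (hQ : Integrable (llr R Q) R) {m n : ℕ → ℕ} (hm : Tendsto m atTop atTop)
    (hn : Tendsto n atTop atTop) {c : ℝ}
    (hc : Tendsto (fun j : ℕ => (m j : ℝ) / (m j + n j)) atTop (𝓝 c)) {b : ℝ}
    (hb : c * (∫ x, llr R P x ∂ R) + (1 - c) * (∫ x, llr R Q x ∂ R) < b)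
    {A : ∀ j, Set ((Fin (m j) → X) × (Fin (n j) → X))} (hA : ∀ᶠ j in atTop, MeasurableSet (A j))
    {δ : ℝ} (hδ : 0 < δ) (hAδ : ∀ᶠ j in atTop, ENNReal.ofReal δ
      ≤ ((Measure.pi fun _ => R).prod (Measure.pi fun _ => R)) (A j)) :
    ∀ᶠ j in atTop, expRate (m j + n j)
      (((Measure.pi fun _ => P).prod (Measure.pi fun _ => Q)) (A j)) ≤ b := by
  set a₁ := ∫ x, llr R P x ∂ R
  set a₂ := ∫ x, llr R Q x ∂ R
  set η := (b - (c * a₁ + (1 - c) * a₂)) / 2 with hη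
  have hη0 : 0 < η := by linarith
  have hδ4 : 0 < ENNReal.ofReal (δ / 4) := ENNReal.ofReal_pos.2 (by linarith)
  have h₁ := ((tendsto_measure_pi_sum_gt R (measurable_llr R P) hP
    (show a₁ < a₁ + η by linarith)).comp hm).eventually (gt_mem_nhds hδ4)
  have h₂ := ((tendsto_measure_pi_sum_gt R (measurable_llr R Q) hQ
    (show a₂ < a₂ + η by linarith)).comp hn).eventually (gt_mem_nhds hδ4)
  have h₃ := (tendsto_add_mul_atBot hm hc (a₁ := a₁ + η) (a₂ := a₂ + η) (b := b)
    (by linarith)).eventually_le_atBot (Real.log (δ / 2))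
  filter_upwards [hA, hAδ, h₁, h₂, h₃, hm.eventually_gt_atTop 0] with j hAj hj hj₁ hj₂ hj₃ hmj
  refine expRate_le (by omega) ?_
  set T := m j * (a₁ + η) + n j * (a₂ + η) with hT
  set p := ((Measure.pi fun _ => P).prod (Measure.pi fun _ => Q)) (A j) with hp
  have hptop : p ≠ ⊤ := measure_ne_top _ _
  have hm₁ : MeasurableSet {y : Fin (m j) → X | m j * (a₁ + η) < ∑ i, llr R P (y i)} :=
    measurableSet_lt measurable_const
      (Finset.measurable_sum _ fun i _ => (measurable_llr R P).comp (measurable_pi_apply i))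
  have hm₂ : MeasurableSet {x : Fin (n j) → X | n j * (a₂ + η) < ∑ i, llr R Q (x i)} :=
    measurableSet_lt measurable_const
      (Finset.measurable_sum _ fun i _ => (measurable_llr R Q).comp (measurable_pi_apply i))
  have hle : ENNReal.ofReal δ ≤ ENNReal.ofReal (Real.exp T) * p + ENNReal.ofReal (δ / 4)
      + ENNReal.ofReal (δ / 4) := by
    refine hj.trans ((measure_mono fun q hq => ?_).trans ((measure_union_le
      ((A j ∩ {p | ∑ i, llr R P (p.1 i) ≤ m j * (a₁ + η) ∧ ∑ i, llr R Q (p.2 i) ≤ n j * (a₂ + η)})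
        ∪ (Prod.fst ⁻¹' {y : Fin (m j) → X | m j * (a₁ + η) < ∑ i, llr R P (y i)}))
      (Prod.snd ⁻¹' {x : Fin (n j) → X | n j * (a₂ + η) < ∑ i, llr R Q (x i)})).trans
      (add_le_add ((measure_union_le _ _).trans (add_le_add
        (measure_inter_llr_le hRP hRQ hAj _ _) ?_)) ?_)))
    · by_cases hq₁ : ∑ i, llr R P (q.1 i) ≤ m j * (a₁ + η)
      · by_cases hq₂ : ∑ i, llr R Q (q.2 i) ≤ n j * (a₂ + η)
        · exact Or.inl (Or.inl ⟨hq, hq₁, hq₂⟩)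
        · exact Or.inr (not_le.1 hq₂)
      · exact Or.inl (Or.inr (not_le.1 hq₁))
    · rw [measurePreserving_fst.measure_preimage hm₁.nullMeasurableSet]
      exact hj₁.le
    · rw [measurePreserving_snd.measure_preimage hm₂.nullMeasurableSet]
      exact hj₂.le
  rw [← ENNReal.ofReal_toReal hptop, ← ENNReal.ofReal_mul (Real.exp_pos _).le,
    ← ENNReal.ofReal_add (by positivity) (by positivity),
    ← ENNReal.ofReal_add (by positivity) (by positivity),
    ENNReal.ofReal_le_ofReal_iff (by positivity)] at hle
  rw [ENNReal.ofReal_le_iff_le_toReal hptop]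
  rw [Real.le_log_iff_exp_le (by positivity), sub_eq_add_neg, Real.exp_add] at hj₃
  have hpos := Real.exp_pos T
  refine le_of_mul_le_mul_left ?_ hpos
  linarith

end LowerBound

section Variational

open scoped BoundedContinuousFunction

variable {X : Type*} [MeasurableSpace X]

/-- The functional `f ↦ ∫ f dR - log ∫ exp f dP` of the Donsker-Varadhan formula. -/
def variationalGap (R P : Measure X) (f : X → ℝ) : ℝ :=
  (∫ x, f x ∂ R) - Real.log (∫ x, Real.exp (f x) ∂P)

lemma klDiv_eq_informationTheory_klDiv (R P : Measure X) [IsProbabilityMeasure R]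
    [IsProbabilityMeasure P] : klDiv R P = InformationTheory.klDiv R P := by
  rw [klDiv, InformationTheory.klDiv_def]
  simp

lemma abs_sub_clamp_le {M x y : ℝ} (hx : |x| ≤ M) : |x - max (-M) (min M y)| ≤ |x - y| := by
  obtain ⟨h₁, h₂⟩ := abs_le.1 hx
  rcases le_total M y with h | h
  · rw [min_eq_left h, max_eq_right (by linarith), abs_sub_comm x M, abs_sub_comm x y]
    rw [abs_of_nonneg (by linarith), abs_of_nonneg (by linarith)]
    linarith
  · rw [min_eq_right h]
    rcases le_total (-M) y with h' | h'
    · rw [max_eq_right h']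
    · rw [max_eq_left h', abs_of_nonneg (by linarith), abs_of_nonneg (by linarith)]
      linarith

lemma exp_sub_exp_le {M x y : ℝ} (hx : x ≤ M) :
    Real.exp x - Real.exp y ≤ Real.exp M * |x - y| := by
  have h : Real.exp x * (1 + (y - x)) ≤ Real.exp y := by
    rw [show Real.exp y = Real.exp x * Real.exp (y - x) by rw [← Real.exp_add]; ring_nf]
    exact mul_le_mul_of_nonneg_left (by linarith [Real.add_one_le_exp (y - x)])
      (Real.exp_pos x).le
  calc Real.exp x - Real.exp y ≤ Real.exp x * (x - y) := by linarith
    _ ≤ Real.exp x * |x - y| := by gcongr; exact le_abs_self _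
    _ ≤ _ := by gcongr

lemma integrable_exp_of_abs_le {P : Measure X} [IsFiniteMeasure P] {f : X → ℝ}
    (hf : AEStronglyMeasurable f P) {M : ℝ} (hM : ∀ x, |f x| ≤ M) :
    Integrable (fun x => Real.exp (f x)) P :=
  Integrable.of_bound (Real.continuous_exp.comp_aestronglyMeasurable hf) (Real.exp M)
    (ae_of_all _ fun x => by
      rw [Real.norm_eq_abs, Real.abs_exp]
      exact Real.exp_le_exp.2 ((le_abs_self _).trans (hM x)))

lemma variationalGap_le_of_forall_boundedContinuous [TopologicalSpace X] [PolishSpace X]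
    [BorelSpace X] {R P : Measure X} [IsProbabilityMeasure R] [IsProbabilityMeasure P] {a : ℝ}
    (h : ∀ f : X →ᵇ ℝ, variationalGap R P f ≤ a) {f : X → ℝ} (hf : Measurable f) {M : ℝ}
    (hM : ∀ x, |f x| ≤ M) : variationalGap R P f ≤ a := by
  have : Nonempty X := R.nonempty_of_neZero
  have hM0 : 0 ≤ M := (abs_nonneg _).trans (hM (Classical.arbitrary X))
  have hfint : ∀ μ : Measure X, [IsFiniteMeasure μ] → Integrable f μ := fun μ _ =>
    Integrable.of_bound hf.aestronglyMeasurable M (ae_of_all _ hM)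
  have hpos : 0 < ∫ x, Real.exp (f x) ∂P :=
    integral_exp_pos (integrable_exp_of_abs_le hf.aestronglyMeasurable hM)
  have key : ∀ ε > 0, (∫ x, f x ∂ R)
      ≤ a + Real.log ((∫ x, Real.exp (f x) ∂P) + Real.exp M * ε) + ε := by
    intro ε hε
    obtain ⟨g₀, hg₀, -⟩ := (hfint (R + P)).exists_boundedContinuous_integral_sub_le hε
    let g : X →ᵇ ℝ := BoundedContinuousFunction.ofNormedAddCommGroup
      (fun x => max (-M) (min M (g₀ x))) (by fun_prop) M fun x => by
        rw [Real.norm_eq_abs, abs_le]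
        exact ⟨le_max_left _ _, max_le (by linarith) (min_le_left _ _)⟩
    have hgM : ∀ x, |g x| ≤ M := fun x => by
      rw [abs_le]
      exact ⟨le_max_left _ _, max_le (by linarith) (min_le_left _ _)⟩
    have hgm : Measurable g := g.continuous.measurable
    have hgint : ∀ μ : Measure X, [IsFiniteMeasure μ] → Integrable g μ := fun μ _ =>
      g.integrable μ
    have habs : ∀ μ : Measure X, [IsFiniteMeasure μ] → Integrable (fun x => |f x - g x|) μ :=
      fun μ _ => ((hfint μ).sub (hgint μ)).abs
    have hsum : (∫ x, |f x - g x| ∂ R) + ∫ x, |f x - g x| ∂P ≤ ε := by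
      rw [← integral_add_measure (habs R) (habs P)]
      refine le_trans (integral_mono (habs _) ((hfint _).sub (g₀.integrable _)).norm fun x => ?_)
        hg₀
      exact abs_sub_clamp_le (hM x)
    have hnonneg₁ : 0 ≤ ∫ x, |f x - g x| ∂ R := integral_nonneg fun x => abs_nonneg _
    have hnonneg₂ : 0 ≤ ∫ x, |f x - g x| ∂P := integral_nonneg fun x => abs_nonneg _
    have h₁ : (∫ x, f x ∂ R) - ∫ x, g x ∂ R ≤ ε := by
      rw [← integral_sub (hfint R) (hgint R)]
      refine le_trans (integral_mono ((hfint R).sub (hgint R)) (habs R) fun x => le_abs_self _) ?_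
      linarith
    have hgexp := integrable_exp_of_abs_le (P := P) hgm.aestronglyMeasurable hgM
    have h₂ : (∫ x, Real.exp (g x) ∂P) ≤ (∫ x, Real.exp (f x) ∂P) + Real.exp M * ε := by
      have hfexp := integrable_exp_of_abs_le (P := P) hf.aestronglyMeasurable hM
      have : (∫ x, Real.exp (g x) ∂P) - ∫ x, Real.exp (f x) ∂P
          ≤ Real.exp M * ∫ x, |f x - g x| ∂P := by
        rw [← integral_sub hgexp hfexp, ← integral_const_mul]
        refine integral_mono (hgexp.sub hfexp) ((habs P).const_mul _) fun x => ?_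
        dsimp only
        rw [abs_sub_comm]
        exact exp_sub_exp_le ((le_abs_self _).trans (hgM x))
      nlinarith [Real.exp_pos M]
    have h₃ := h g
    rw [variationalGap] at h₃
    have h₄ := Real.log_le_log (integral_exp_pos hgexp) h₂
    linarith
  have hlim : Tendsto (fun ε : ℝ => a + Real.log ((∫ x, Real.exp (f x) ∂P) + Real.exp M * ε) + ε)
      (𝓝[>] 0) (𝓝 (a + Real.log ((∫ x, Real.exp (f x) ∂P) + Real.exp M * 0) + 0)) := by
    refine Tendsto.mono_left (ContinuousAt.tendsto ?_) nhdsWithin_le_nhds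
    refine (continuousAt_const.add (ContinuousAt.log ?_ ?_)).add continuousAt_id
    · fun_prop
    · simpa using hpos.ne'
  have hle := ge_of_tendsto hlim (eventually_mem_nhdsWithin.mono fun ε hε => key ε hε)
  rw [mul_zero, add_zero, add_zero] at hle
  rw [variationalGap]
  linarith

lemma absolutelyContinuous_of_forall_variationalGap_le {R P : Measure X} [IsProbabilityMeasure R]
    [IsProbabilityMeasure P] {a : ℝ}
    (h : ∀ f : X → ℝ, Measurable f → ∀ M : ℝ, (∀ x, |f x| ≤ M) → variationalGap R P f ≤ a) :
    R ≪ P := by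
  refine Measure.AbsolutelyContinuous.mk fun A hA hPA => ?_
  have key : ∀ t : ℝ, 0 ≤ t → t * R.real A ≤ a := fun t ht => by
    have ht' := h (A.indicator fun _ => t) (measurable_const.indicator hA) t fun x => by
      by_cases hx : x ∈ A
      · rw [Set.indicator_of_mem hx, abs_of_nonneg ht]
      · rw [Set.indicator_of_notMem hx]
        simpa using ht
    have hexp : ∫ x, Real.exp (A.indicator (fun _ => t) x) ∂P = 1 := by
      have : (fun x => Real.exp (A.indicator (fun _ => t) x)) =ᵐ[P] fun _ => 1 := by
        filter_upwards [measure_eq_zero_iff_ae_notMem.1 hPA] with x hx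
        rw [Set.indicator_of_notMem hx, Real.exp_zero]
      rw [integral_congr_ae this]
      simp
    rw [variationalGap, hexp, Real.log_one, integral_indicator_const _ hA, smul_eq_mul] at ht'
    linarith
  by_contra hR
  have hpos : 0 < R.real A := ENNReal.toReal_pos hR (measure_ne_top _ _)
  have ha : 0 ≤ a := by simpa using key 0 le_rfl
  have := key ((a + 1) / R.real A) (by positivity)
  rw [div_mul_cancel₀ _ hpos.ne'] at this
  linarith

/-- The truncation of `r` to `[exp (-n), exp n]`. -/
def expClamp (n : ℕ) (r : ℝ) : ℝ := max (Real.exp (-n)) (min (Real.exp n) r)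

lemma exp_neg_le_expClamp (n : ℕ) (r : ℝ) : Real.exp (-n) ≤ expClamp n r := le_max_left _ _

lemma expClamp_pos (n : ℕ) (r : ℝ) : 0 < expClamp n r :=
  (Real.exp_pos _).trans_le (exp_neg_le_expClamp n r)

lemma expClamp_le_exp (n : ℕ) (r : ℝ) : expClamp n r ≤ Real.exp n :=
  max_le (Real.exp_le_exp.2 (by linarith [n.cast_nonneg (α := ℝ)])) (min_le_left _ _)

lemma expClamp_le_add (n : ℕ) {r : ℝ} (hr : 0 ≤ r) : expClamp n r ≤ r + Real.exp (-n) :=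
  max_le (by linarith) ((min_le_right _ _).trans (by linarith [Real.exp_pos (-n : ℝ)]))

lemma abs_log_expClamp_le (n : ℕ) (r : ℝ) : |Real.log (expClamp n r)| ≤ n := by
  rw [abs_le, Real.le_log_iff_exp_le (expClamp_pos n r), Real.log_le_iff_le_exp (expClamp_pos n r)]
  exact ⟨exp_neg_le_expClamp n r, expClamp_le_exp n r⟩

lemma mul_log_expClamp_nonneg {n : ℕ} (hn : 1 ≤ n) {r : ℝ} (hr : 0 ≤ r) :
    0 ≤ r * Real.log (expClamp n r) + (1 - r) := by
  have hu := expClamp_pos n r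
  rcases le_or_gt r (expClamp n r) with h | h
  · have h₁ : r * (1 - (expClamp n r)⁻¹) ≤ r * Real.log (expClamp n r) :=
      mul_le_mul_of_nonneg_left (Real.one_sub_inv_le_log_of_pos hu) hr
    have h₂ : r * (expClamp n r)⁻¹ ≤ 1 := by rwa [← div_eq_mul_inv, div_le_one hu]
    linarith
  · have hmin : expClamp n r = Real.exp n := by
      rcases le_total (Real.exp n) r with h' | h'
      · rw [expClamp, min_eq_left h', max_eq_right (Real.exp_le_exp.2 (by
          linarith [n.cast_nonneg (α := ℝ)]))]
      · rw [expClamp, min_eq_right h'] at h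
        exact absurd (le_max_right _ _) (not_le.2 h)
    rw [hmin, Real.log_exp]
    have : (1 : ℝ) ≤ n := by exact_mod_cast hn
    nlinarith

lemma tendsto_mul_log_expClamp {r : ℝ} (hr : 0 ≤ r) :
    Tendsto (fun n : ℕ => r * Real.log (expClamp n r) + (1 - r)) atTop
      (𝓝 (InformationTheory.klFun r)) := by
  rw [InformationTheory.klFun_apply, add_sub_assoc]
  rcases hr.eq_or_lt with rfl | hr
  · simp
  refine tendsto_const_nhds.congr' ?_
  filter_upwards [(tendsto_natCast_atTop_atTop (R := ℝ)).eventually_ge_atTop |Real.log r|] with n hn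
  obtain ⟨h₁, h₂⟩ := abs_le.1 hn
  rw [expClamp, min_eq_right ((Real.log_le_iff_le_exp hr).1 h₂),
    max_eq_right ((Real.le_log_iff_exp_le hr).1 h₁)]

lemma klDiv_le_of_forall_variationalGap_le {R P : Measure X} [IsProbabilityMeasure R]
    [IsProbabilityMeasure P] {a : ℝ}
    (h : ∀ f : X → ℝ, Measurable f → ∀ M : ℝ, (∀ x, |f x| ≤ M) → variationalGap R P f ≤ a) :
    klDiv R P ≤ ENNReal.ofReal a := by
  have hac := absolutelyContinuous_of_forall_variationalGap_le h
  rw [klDiv_eq_informationTheory_klDiv, InformationTheory.klDiv_eq_lintegral_klFun_of_ac hac]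
  set r := fun x => (R.rnDeriv P x).toReal with hr
  have hrm : Measurable r := (Measure.measurable_rnDeriv R P).ennreal_toReal
  have hr0 : ∀ x, 0 ≤ r x := fun x => ENNReal.toReal_nonneg
  have hrint : Integrable r P := Measure.integrable_toReal_rnDeriv
  have hr1 : ∫ x, r x ∂P = 1 := by
    rw [hr, Measure.integral_toReal_rnDeriv hac]
    simp
  have hcm : ∀ n : ℕ, Measurable fun x => expClamp n (r x) := fun n =>
    measurable_const.max (measurable_const.min hrm)
  have hlogm : ∀ n : ℕ, Measurable fun x => Real.log (expClamp n (r x)) := fun n => (hcm n).log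
  have hlogint : ∀ n : ℕ, Integrable (fun x => Real.log (expClamp n (r x))) R := fun n =>
    Integrable.of_bound (hlogm n).aestronglyMeasurable n
      (ae_of_all _ fun x => abs_log_expClamp_le n (r x))
  have hgap : ∀ n : ℕ, ∫ x, Real.log (expClamp n (r x)) ∂ R ≤ a + Real.exp (-n) := fun n => by
    have hn := h _ (hlogm n) n fun x => abs_log_expClamp_le n (r x)
    rw [variationalGap] at hn
    simp only [Real.exp_log (expClamp_pos n _)] at hn
    have hcint : Integrable (fun x => expClamp n (r x)) P :=
      Integrable.of_bound (hcm n).aestronglyMeasurable (Real.exp n) (ae_of_all _ fun x => by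
        rw [Real.norm_eq_abs, abs_of_pos (expClamp_pos _ _)]
        exact expClamp_le_exp n _)
    have hle : ∫ x, expClamp n (r x) ∂P ≤ 1 + Real.exp (-n) := by
      refine (integral_mono hcint (hrint.add (integrable_const _))
        fun x => expClamp_le_add n (hr0 x)).trans_eq ?_
      simp only [Pi.add_apply]
      rw [integral_add hrint (integrable_const _), hr1]
      simp
    have hpos : 0 < ∫ x, expClamp n (r x) ∂P := by
      have := integral_mono (integrable_const (Real.exp (-n))) hcint
        fun x => exp_neg_le_expClamp n (r x)
      rw [integral_const, probReal_univ, one_smul] at this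
      exact (Real.exp_pos _).trans_le this
    linarith [Real.log_le_sub_one_of_pos hpos]
  have hlint : ∀ n : ℕ, 1 ≤ n →
      ∫⁻ x, ENNReal.ofReal (r x * Real.log (expClamp n (r x)) + (1 - r x)) ∂P
        ≤ ENNReal.ofReal (a + Real.exp (-n)) := fun n hn => by
    have hmulint : Integrable (fun x => r x * Real.log (expClamp n (r x))) P :=
      (integrable_toReal_rnDeriv_mul_iff hac).2 (hlogint n)
    have hsubint : Integrable (fun x => 1 - r x) P := (integrable_const 1).sub hrint
    have hint : Integrable (fun x => r x * Real.log (expClamp n (r x)) + (1 - r x)) P :=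
      hmulint.add hsubint
    rw [← ofReal_integral_eq_lintegral_ofReal hint (ae_of_all _ fun x =>
      mul_log_expClamp_nonneg hn (hr0 x))]
    refine ENNReal.ofReal_le_ofReal ?_
    rw [integral_add hmulint hsubint,
      integral_sub (integrable_const 1) hrint, hr1]
    have := integral_rnDeriv_smul hac (f := fun x => Real.log (expClamp n (r x)))
    simp only [smul_eq_mul] at this
    rw [this]
    simpa using hgap n
  have hlim : Tendsto (fun n : ℕ => ENNReal.ofReal (a + Real.exp (-n))) atTop
      (𝓝 (ENNReal.ofReal a)) := by
    refine ENNReal.tendsto_ofReal ?_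
    simpa using tendsto_const_nhds.add
      (Real.tendsto_exp_neg_atTop_nhds_zero.comp (tendsto_natCast_atTop_atTop (R := ℝ)))
  calc ∫⁻ x, ENNReal.ofReal (InformationTheory.klFun (r x)) ∂P
      = ∫⁻ x, liminf (fun n : ℕ =>
          ENNReal.ofReal (r x * Real.log (expClamp n (r x)) + (1 - r x))) atTop ∂P :=
        lintegral_congr fun x =>
          (ENNReal.tendsto_ofReal (tendsto_mul_log_expClamp (hr0 x))).liminf_eq.symm
    _ ≤ liminf (fun n : ℕ => ∫⁻ x, ENNReal.ofReal
          (r x * Real.log (expClamp n (r x)) + (1 - r x)) ∂P) atTop :=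
        lintegral_liminf_le fun n =>
          ((hrm.mul (hlogm n)).add (measurable_const.sub hrm)).ennreal_ofReal
    _ ≤ liminf (fun n : ℕ => ENNReal.ofReal (a + Real.exp (-n))) atTop :=
        liminf_le_liminf ((eventually_ge_atTop 1).mono hlint)
    _ = ENNReal.ofReal a := hlim.liminf_eq

lemma exists_lt_variationalGap [TopologicalSpace X] [PolishSpace X] [BorelSpace X]
    {R P Q : Measure X} [IsProbabilityMeasure R] [IsProbabilityMeasure P] [IsProbabilityMeasure Q]
    {c : ℝ} (hc0 : 0 < c) (hc1 : c < 1) {a : ℝ}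
    (ha : ENNReal.ofReal a < ENNReal.ofReal c * klDiv R P + ENNReal.ofReal (1 - c) * klDiv R Q) :
    ∃ f g : X →ᵇ ℝ, a < c * variationalGap R P f + (1 - c) * variationalGap R Q g := by
  by_contra! hcon
  have hzero : ∀ S : Measure X, [IsProbabilityMeasure S] →
      variationalGap R S (0 : X →ᵇ ℝ) = 0 := fun S _ => by simp [variationalGap]
  have hbP : BddAbove (Set.range fun f : X →ᵇ ℝ => variationalGap R P f) := ⟨a / c, by
    rintro _ ⟨f, rfl⟩
    have := hcon f 0
    rw [hzero] at this
    rw [le_div_iff₀ hc0]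
    linarith⟩
  set s := ⨆ f : X →ᵇ ℝ, variationalGap R P f with hs
  have hsP : ∀ f : X →ᵇ ℝ, variationalGap R P f ≤ s := fun f => le_ciSup hbP f
  have hs0 : 0 ≤ s := hzero P ▸ hsP 0
  have hQ : ∀ g : X →ᵇ ℝ, variationalGap R Q g ≤ (a - c * s) / (1 - c) := fun g => by
    rw [le_div_iff₀ (by linarith)]
    have : s ≤ (a - (1 - c) * variationalGap R Q g) / c := ciSup_le fun f => by
      rw [le_div_iff₀ hc0]
      linarith [hcon f g]
    rw [le_div_iff₀ hc0] at this
    linarith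
  have ht0 : 0 ≤ (a - c * s) / (1 - c) := hzero Q ▸ hQ 0
  have h₁ : klDiv R P ≤ ENNReal.ofReal s := klDiv_le_of_forall_variationalGap_le
    fun f hf M hM => variationalGap_le_of_forall_boundedContinuous hsP hf hM
  have h₂ : klDiv R Q ≤ ENNReal.ofReal ((a - c * s) / (1 - c)) :=
    klDiv_le_of_forall_variationalGap_le
      fun f hf M hM => variationalGap_le_of_forall_boundedContinuous hQ hf hM
  refine absurd ha (not_lt.2 ?_)
  calc _ ≤ ENNReal.ofReal c * ENNReal.ofReal s
        + ENNReal.ofReal (1 - c) * ENNReal.ofReal ((a - c * s) / (1 - c)) := by gcongr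
    _ = ENNReal.ofReal a := by
      rw [← ENNReal.ofReal_mul hc0.le, ← ENNReal.ofReal_mul (by linarith),
        ← ENNReal.ofReal_add (by positivity) (mul_nonneg (by linarith) ht0)]
      congr 1
      have : 1 - c ≠ 0 := by linarith
      field_simp
      ring

end Variational

section Chernoff

variable {X : Type*} [MeasurableSpace X]

lemma measure_pi_le_sum_le (P : Measure X) [IsProbabilityMeasure P] {f : X → ℝ}
    (hf : Measurable f) (m : ℕ) (s : ℝ) :
    (Measure.pi fun _ : Fin m => P) {y | s ≤ ∑ i, f (y i)}
      ≤ ENNReal.ofReal (Real.exp (-s)) * (∫⁻ x, ENNReal.ofReal (Real.exp (f x)) ∂P) ^ m := by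
  have hfe : Measurable fun x => ENNReal.ofReal (Real.exp (f x)) :=
    (Real.measurable_exp.comp hf).ennreal_ofReal
  have h := mul_meas_ge_le_lintegral (μ := Measure.pi fun _ : Fin m => P)
    (f := fun y => ∏ i, ENNReal.ofReal (Real.exp (f (y i))))
    (Finset.measurable_fun_prod _ fun i _ => hfe.comp (measurable_pi_apply i))
    (ENNReal.ofReal (Real.exp s))
  rw [lintegral_pi_prod P fun _ => hfe, Finset.prod_const, Finset.card_univ, Fintype.card_fin] at h
  have hset : {y : Fin m → X | ENNReal.ofReal (Real.exp s)
      ≤ ∏ i, ENNReal.ofReal (Real.exp (f (y i)))} = {y | s ≤ ∑ i, f (y i)} := by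
    ext y
    simp only [Set.mem_ofPred_eq]
    rw [← ENNReal.ofReal_prod_of_nonneg fun i _ => (Real.exp_pos _).le, ← Real.exp_sum,
      ENNReal.ofReal_le_ofReal_iff (Real.exp_pos _).le, Real.exp_le_exp]
  rw [hset] at h
  calc _ = ENNReal.ofReal (Real.exp (-s)) * (ENNReal.ofReal (Real.exp s)
        * (Measure.pi fun _ : Fin m => P) {y | s ≤ ∑ i, f (y i)}) := by
        rw [← mul_assoc, ← ENNReal.ofReal_mul (Real.exp_pos _).le, ← Real.exp_add]
        simp
    _ ≤ _ := by gcongr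

lemma measure_pi_lt_integral_empMeas_le [MeasurableSingletonClass X] [Nonempty X] (R P : Measure X)
    [IsProbabilityMeasure P] {f : X → ℝ} (hf : Measurable f) {M : ℝ} (hM : ∀ x, |f x| ≤ M)
    {m : ℕ} (hm : 0 < m) (η : ℝ) :
    (Measure.pi fun _ : Fin m => P) {y | (∫ x, f x ∂ R) - η < ∫ x, f x ∂(empMeas m y : Measure X)}
      ≤ ENNReal.ofReal (Real.exp (-(m * (variationalGap R P f - η)))) := by
  have hm' : (0 : ℝ) < m := by positivity
  have hint := integrable_exp_of_abs_le (P := P) hf.aestronglyMeasurable hM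
  refine (measure_mono fun y hy => ?_).trans
    ((measure_pi_le_sum_le P hf m (m * ((∫ x, f x ∂ R) - η))).trans_eq ?_)
  · rw [Set.mem_ofPred_eq, integral_empMeas hm, inv_mul_eq_div, lt_div_iff₀ hm'] at hy
    rw [Set.mem_ofPred_eq, mul_comm]
    exact hy.le
  · rw [← ofReal_integral_eq_lintegral_ofReal hint (ae_of_all _ fun x => (Real.exp_pos _).le),
      ← ENNReal.ofReal_pow (integral_nonneg fun x => (Real.exp_pos _).le),
      ← ENNReal.ofReal_mul (Real.exp_pos _).le]
    conv_lhs => rw [← Real.exp_log (integral_exp_pos hint), ← Real.exp_nat_mul, ← Real.exp_add]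
    congr 2
    rw [variationalGap]
    ring

lemma measure_pi_lt_empMeas_le [MeasurableSingletonClass X] [Nonempty X] (P : Measure X)
    [IsProbabilityMeasure P] {s : Set X} (hs : MeasurableSet s) {t : ℝ}
    (ht0 : 0 ≤ t) (ht : P s ≤ ENNReal.ofReal (Real.exp (-t))) {m : ℕ} (hm : 0 < m) (u : ℝ) :
    (Measure.pi fun _ : Fin m => P) {y | u < (empMeas m y : Measure X).real s}
      ≤ ENNReal.ofReal (Real.exp (m * (Real.log 2 - t * u))) := by
  have hm' : (0 : ℝ) < m := by positivity
  have hf : Measurable (s.indicator fun _ => t) := measurable_const.indicator hs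
  refine (measure_mono fun y hy => ?_).trans
    ((measure_pi_le_sum_le P hf m (m * (t * u))).trans ?_)
  · have hint : t * (empMeas m y : Measure X).real s
        = (m : ℝ)⁻¹ * ∑ i, s.indicator (fun _ => t) (y i) := by
      rw [← integral_empMeas hm, integral_indicator_const t hs, smul_eq_mul, mul_comm]
    rw [Set.mem_ofPred_eq] at hy ⊢
    rw [← mul_le_mul_iff_right₀ (inv_pos.2 hm'), inv_mul_cancel_left₀ hm'.ne', ← hint]
    exact mul_le_mul_of_nonneg_left hy.le ht0
  · have h2 : ∫⁻ x, ENNReal.ofReal (Real.exp (s.indicator (fun _ => t) x)) ∂P ≤ 2 := by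
      calc _ ≤ ∫⁻ x, 1 + s.indicator (fun _ => ENNReal.ofReal (Real.exp t)) x ∂P := by
            refine lintegral_mono fun x => ?_
            by_cases hx : x ∈ s <;> simp [hx]
        _ = 1 + ENNReal.ofReal (Real.exp t) * P s := by
            rw [lintegral_add_left measurable_const, lintegral_indicator_const hs]
            simp
        _ ≤ 1 + ENNReal.ofReal (Real.exp t) * ENNReal.ofReal (Real.exp (-t)) := by gcongr
        _ = 2 := by
            rw [← ENNReal.ofReal_mul (Real.exp_pos _).le, ← Real.exp_add]
            simp [one_add_one_eq_two]
    calc _ ≤ ENNReal.ofReal (Real.exp (-(m * (t * u)))) * 2 ^ m := by gcongr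
      _ = _ := by
        rw [show (2 : ℝ≥0∞) = ENNReal.ofReal 2 by simp, ← ENNReal.ofReal_pow (by norm_num),
          ← ENNReal.ofReal_mul (Real.exp_pos _).le]
        congr 1
        conv_lhs => rw [← Real.exp_log (show (0 : ℝ) < 2 by norm_num), ← Real.exp_nat_mul,
          ← Real.exp_add]
        congr 1
        ring

end Chernoff

section ExponentialTightness

variable {X : Type*} [MeasurableSpace X] [TopologicalSpace X] [PolishSpace X] [BorelSpace X]
  [Nonempty X]

lemma exists_isCompact_measure_pi_empMeas_notMem_le (P : Measure X) [IsProbabilityMeasure P]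
    {L : ℝ} (hL : 0 ≤ L) : ∃ 𝒦 : Set (ProbabilityMeasure X), IsCompact 𝒦 ∧ ∀ m : ℕ, 0 < m →
      (Measure.pi fun _ : Fin m => P) {y | empMeas m y ∉ 𝒦}
        ≤ ENNReal.ofReal (Real.exp (-(m * L))) := by
  let t : ℕ → ℝ := fun j => (j + 1) * (L + (j + 2) * Real.log 2)
  have hlog : 0 < Real.log 2 := Real.log_pos (by norm_num)
  have ht0 : ∀ j, 0 ≤ t j := fun j => by positivity
  have htight := isTightMeasureSet_iff_exists_isCompact_measure_compl_le.1
    (isTightMeasureSet_singleton (μ := P))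
  choose C hC hPC using fun j => htight (ENNReal.ofReal (Real.exp (-t j)))
    (ENNReal.ofReal_pos.2 (Real.exp_pos _))
  let u : ℕ → NNReal := fun j => 1 / ((j : NNReal) + 1)
  have hu : Tendsto u atTop (𝓝 0) := tendsto_one_div_add_atTop_nhds_zero_nat
  refine ⟨{S | ∀ j, S (C j)ᶜ ≤ u j},
    isCompact_setOfPred_probabilityMeasure_mass_eq_compl_isCompact_le hu hC
      (Or.inl inferInstance), fun m hm => ?_⟩
  have hset : {y : Fin m → X | empMeas m y ∉ {S : ProbabilityMeasure X | ∀ j, S (C j)ᶜ ≤ u j}}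
      ⊆ ⋃ j, {y | (u j : ℝ) < (empMeas m y : Measure X).real (C j)ᶜ} := by
    intro y hy
    simp only [Set.mem_ofPred_eq, not_forall, not_le] at hy
    obtain ⟨j, hj⟩ := hy
    exact Set.mem_iUnion.2 ⟨j, NNReal.coe_lt_coe.2 hj⟩
  have hj : ∀ j, (Measure.pi fun _ : Fin m => P)
      {y | (u j : ℝ) < (empMeas m y : Measure X).real (C j)ᶜ}
      ≤ ENNReal.ofReal (Real.exp (-(m * L))) * (2⁻¹ : ℝ≥0∞) ^ (j + 1) := by
    intro j
    refine (measure_pi_lt_empMeas_le P (hC j).measurableSet.compl (ht0 j) (hPC j P rfl) hm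
      (u j : ℝ)).trans ?_
    have hm1 : (1 : ℝ) ≤ m := by exact_mod_cast hm
    have htu : t j * (u j : ℝ) = L + (j + 2) * Real.log 2 := by
      simp only [t, u]
      push_cast
      field_simp
    rw [show (2⁻¹ : ℝ≥0∞) = ENNReal.ofReal (Real.exp (-Real.log 2)) by
        rw [Real.exp_neg, Real.exp_log two_pos, ENNReal.ofReal_inv_of_pos two_pos]
        simp,
      ← ENNReal.ofReal_pow (Real.exp_pos _).le, ← Real.exp_nat_mul,
      ← ENNReal.ofReal_mul (Real.exp_pos _).le, ← Real.exp_add, htu]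
    refine ENNReal.ofReal_le_ofReal (Real.exp_le_exp.2 ?_)
    push_cast
    nlinarith [mul_nonneg (mul_nonneg (sub_nonneg.2 hm1) (by positivity : (0 : ℝ) ≤ j + 1)) hlog.le]
  calc _ ≤ ∑' j, (Measure.pi fun _ : Fin m => P)
        {y | (u j : ℝ) < (empMeas m y : Measure X).real (C j)ᶜ} :=
        (measure_mono hset).trans (measure_iUnion_le _)
    _ ≤ ∑' j : ℕ, ENNReal.ofReal (Real.exp (-(m * L))) * (2⁻¹ : ℝ≥0∞) ^ (j + 1) :=
        ENNReal.tsum_le_tsum hj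
    _ = _ := by
        rw [ENNReal.tsum_mul_left, ENNReal.tsum_geometric_add_one, ENNReal.one_sub_inv_two,
          inv_inv, ENNReal.inv_mul_cancel (by norm_num) (by norm_num), mul_one]

end ExponentialTightness

lemma isOpen_mmd_lt {X : Type*} [MeasurableSpace X] [TopologicalSpace X] [OpensMeasurableSpace X]
    {k : X → X → ℝ}
    (h_tri : ∀ R S T : ProbabilityMeasure X,
      mmd k (R : Measure X) (T : Measure X)
        ≤ mmd k (R : Measure X) (S : Measure X) + mmd k (S : Measure X) (T : Measure X))
    (h_metrize : ∀ s : Set (ProbabilityMeasure X),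
      IsOpen s ↔ ∀ R ∈ s, ∃ ε > 0,
        ∀ S : ProbabilityMeasure X, mmd k (S : Measure X) (R : Measure X) < ε → S ∈ s)
    (R : ProbabilityMeasure X) (r : ℝ) :
    IsOpen {S : ProbabilityMeasure X | mmd k (S : Measure X) (R : Measure X) < r} := by
  refine (h_metrize _).2 fun S hS => ⟨r - mmd k (S : Measure X) (R : Measure X),
    sub_pos.2 hS, fun T hT => ?_⟩
  rw [Set.mem_ofPred_eq]
  linarith [h_tri T S R]

section UpperBound

variable {X : Type*} [MeasurableSpace X] [TopologicalSpace X] [PolishSpace X] [BorelSpace X]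
  [Nonempty X]

lemma exists_isOpen_eventually_measure_empMeas_mem_le {P Q : Measure X} [IsProbabilityMeasure P]
    [IsProbabilityMeasure Q] {m n : ℕ → ℕ} (hm : Tendsto m atTop atTop)
    (hn : Tendsto n atTop atTop) {c : ℝ} (hc0 : 0 < c) (hc1 : c < 1)
    (hc : Tendsto (fun j : ℕ => (m j : ℝ) / (m j + n j)) atTop (𝓝 c)) {a : ℝ}
    {R : ProbabilityMeasure X}
    (ha : ENNReal.ofReal a < ENNReal.ofReal c * klDiv (R : Measure X) P
      + ENNReal.ofReal (1 - c) * klDiv (R : Measure X) Q) :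
    ∃ U : Set (ProbabilityMeasure X), IsOpen U ∧ R ∈ U ∧ ∀ᶠ j in atTop,
      ((Measure.pi fun _ : Fin (m j) => P).prod (Measure.pi fun _ : Fin (n j) => Q))
          {p | empMeas (m j) p.1 ∈ U ∧ empMeas (n j) p.2 ∈ U}
        ≤ ENNReal.ofReal (Real.exp (-((m j + n j : ℕ) * a))) := by
  obtain ⟨f, g, hfg⟩ := exists_lt_variationalGap hc0 hc1 ha
  set η := (c * variationalGap R P f + (1 - c) * variationalGap R Q g - a) / 2 with hη
  have hη0 : 0 < η := by linarith
  have hopen : ∀ f : BoundedContinuousFunction X ℝ, IsOpen {S : ProbabilityMeasure X |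
      (∫ x, f x ∂(R : Measure X)) - η < ∫ x, f x ∂(S : Measure X)} := fun f =>
    isOpen_lt continuous_const
      (ProbabilityMeasure.continuous_integral_boundedContinuousFunction f)
  refine ⟨_, (hopen f).inter (hopen g), ⟨by simpa using hη0, by simpa using hη0⟩, ?_⟩
  have hlim := (tendsto_add_mul_atBot hm hc (a₁ := -(variationalGap R P f - η))
    (a₂ := -(variationalGap R Q g - η)) (b := -a) (by linarith)).eventually_le_atBot 0
  filter_upwards [hlim, hm.eventually_gt_atTop 0, hn.eventually_gt_atTop 0] with j hj hmj hnj
  calc _ ≤ ((Measure.pi fun _ : Fin (m j) => P).prod (Measure.pi fun _ : Fin (n j) => Q))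
        ({y | (∫ x, f x ∂(R : Measure X)) - η < ∫ x, f x ∂(empMeas (m j) y : Measure X)}
          ×ˢ {y | (∫ x, g x ∂(R : Measure X)) - η < ∫ x, g x ∂(empMeas (n j) y : Measure X)}) :=
        measure_mono fun p hp => ⟨hp.1.1, hp.2.2⟩
    _ ≤ ENNReal.ofReal (Real.exp (-(m j * (variationalGap R P f - η))))
        * ENNReal.ofReal (Real.exp (-(n j * (variationalGap R Q g - η)))) := by
        rw [Measure.prod_prod]
        exact mul_le_mul'
          (measure_pi_lt_integral_empMeas_le _ P f.continuous.measurable f.norm_coe_le_norm hmj η)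
          (measure_pi_lt_integral_empMeas_le _ Q g.continuous.measurable g.norm_coe_le_norm hnj η)
    _ ≤ _ := by
        rw [← ENNReal.ofReal_mul (Real.exp_pos _).le, ← Real.exp_add]
        refine ENNReal.ofReal_le_ofReal (Real.exp_le_exp.2 ?_)
        linarith

lemma eventually_le_expRate {k : X → X → ℝ} (hk : Measurable fun p : X × X => k p.1 p.2)
    (hk_symm : ∀ x y, k x y = k y x) {K : ℝ} (hk_bdd : ∀ x y, k x y ∈ Set.Icc (0 : ℝ) K)
    (h_self : ∀ R : ProbabilityMeasure X, mmd k (R : Measure X) (R : Measure X) = 0)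
    (h_tri : ∀ R S T : ProbabilityMeasure X,
      mmd k (R : Measure X) (T : Measure X)
        ≤ mmd k (R : Measure X) (S : Measure X) + mmd k (S : Measure X) (T : Measure X))
    (h_metrize : ∀ s : Set (ProbabilityMeasure X),
      IsOpen s ↔ ∀ R ∈ s, ∃ ε > 0,
        ∀ S : ProbabilityMeasure X, mmd k (S : Measure X) (R : Measure X) < ε → S ∈ s)
    {P Q : Measure X} [IsProbabilityMeasure P] [IsProbabilityMeasure Q] {m n : ℕ → ℕ}
    (hm : Tendsto m atTop atTop) (hn : Tendsto n atTop atTop) {c : ℝ} (hc0 : 0 < c) (hc1 : c < 1)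
    (hc : Tendsto (fun j : ℕ => (m j : ℝ) / (m j + n j)) atTop (𝓝 c)) {a b : ℝ} (hab : a < b)
    (hb : ∀ R : ProbabilityMeasure X, ENNReal.ofReal b < ENNReal.ofReal c * klDiv (R : Measure X) P
      + ENNReal.ofReal (1 - c) * klDiv (R : Measure X) Q)
    {ε : ℕ → ℝ} (hε : Tendsto ε atTop (𝓝 0)) :
    ∀ᶠ j in atTop, a ≤ expRate (m j + n j)
      (((Measure.pi fun _ : Fin (m j) => P).prod (Measure.pi fun _ : Fin (n j) => Q))
        {p | mmd k (empMeas (m j) p.1 : Measure X) (empMeas (n j) p.2 : Measure X) ≤ ε j}) := by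
  choose U hU hRU hUle using fun R =>
    exists_isOpen_eventually_measure_empMeas_mem_le hm hn hc0 hc1 hc (hb R)
  choose r hr hrU using fun R => (h_metrize (U R)).1 (hU R) R (hRU R)
  set L := max 0 (b / c) + 1 with hL
  have hbL : b < c * L := by
    have : b / c < L := by linarith [le_max_right 0 (b / c)]
    rwa [div_lt_iff₀' hc0] at this
  obtain ⟨𝒦, h𝒦, h𝒦le⟩ := exists_isCompact_measure_pi_empMeas_notMem_le P
    (show 0 ≤ L by linarith [le_max_left 0 (b / c)])
  obtain ⟨F, -, hF⟩ := h𝒦.elim_nhds_subcover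
    (fun R => {S : ProbabilityMeasure X | mmd k (S : Measure X) (R : Measure X) < r R / 2})
    fun R _ => (isOpen_mmd_lt h_tri h_metrize R _).mem_nhds (by simpa [h_self] using hr R)
  have hεF : ∀ᶠ j in atTop, ∀ R ∈ F, ε j < r R / 2 :=
    (Finset.eventually_all F).2 fun R _ => hε.eventually (gt_mem_nhds (half_pos (hr R)))
  have hUF : ∀ᶠ j in atTop, ∀ R ∈ F, _ := (Finset.eventually_all F).2 fun R _ => hUle R
  have hlim₁ := (tendsto_add_mul_atBot hm hc (a₁ := -L) (a₂ := 0) (b := -b)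
    (by linarith)).eventually_le_atBot 0
  have hlim₂ := (tendsto_add_mul_atBot hm hc (a₁ := -(b - a)) (a₂ := -(b - a)) (b := 0)
    (by linarith)).eventually_le_atBot (-Real.log (F.card + 1))
  filter_upwards [hεF, hUF, hlim₁, hlim₂, hm.eventually_gt_atTop 0] with j hj₁ hj₂ hj₃ hj₄ hmj
  refine le_expRate (by omega) ?_
  set μ := (Measure.pi fun _ : Fin (m j) => P).prod (Measure.pi fun _ : Fin (n j) => Q)
  set e := ENNReal.ofReal (Real.exp (-((m j + n j : ℕ) * b))) with he
  have hsub : {p : (Fin (m j) → X) × (Fin (n j) → X) |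
        mmd k (empMeas (m j) p.1 : Measure X) (empMeas (n j) p.2 : Measure X) ≤ ε j}
      ⊆ (Prod.fst ⁻¹' {y | empMeas (m j) y ∉ 𝒦})
        ∪ ⋃ R ∈ F, {p | empMeas (m j) p.1 ∈ U R ∧ empMeas (n j) p.2 ∈ U R} := by
    intro p hp
    rw [Set.mem_ofPred_eq] at hp
    by_cases hpK : empMeas (m j) p.1 ∈ 𝒦
    · obtain ⟨R, hRF, hR⟩ := Set.mem_iUnion₂.1 (hF hpK)
      rw [Set.mem_ofPred_eq] at hR
      refine Or.inr (Set.mem_iUnion₂.2 ⟨R, hRF, hrU R _ ?_, hrU R _ ?_⟩)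
      · linarith [hr R]
      · have := h_tri (empMeas (n j) p.2) (empMeas (m j) p.1) R
        rw [mmd_comm hk hk_symm hk_bdd (empMeas (n j) p.2 : Measure X)
          (empMeas (m j) p.1 : Measure X)] at this
        linarith [hj₁ R hRF]
    · exact Or.inl hpK
  have hfst : μ (Prod.fst ⁻¹' {y | empMeas (m j) y ∉ 𝒦}) ≤ e := by
    rw [← Set.prod_univ, Measure.prod_prod, measure_univ, mul_one]
    refine (h𝒦le (m j) hmj).trans (ENNReal.ofReal_le_ofReal (Real.exp_le_exp.2 ?_))
    linarith
  calc _ ≤ e + ∑ R ∈ F, e := (measure_mono hsub).trans ((measure_union_le _ _).trans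
        (add_le_add hfst ((measure_biUnion_finset_le _ _).trans (Finset.sum_le_sum hj₂))))
    _ = ENNReal.ofReal ((F.card + 1) * Real.exp (-((m j + n j : ℕ) * b))) := by
        rw [Finset.sum_const, nsmul_eq_mul, ENNReal.ofReal_mul (by positivity),
          ENNReal.ofReal_add (by positivity) zero_le_one, ENNReal.ofReal_natCast,
          ENNReal.ofReal_one, ← he]
        ring
    _ ≤ _ := by
        refine ENNReal.ofReal_le_ofReal ?_
        conv_lhs => rw [← Real.exp_log (show (0 : ℝ) < F.card + 1 by positivity), ← Real.exp_add]
        refine Real.exp_le_exp.2 ?_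
        push_cast at hj₄ ⊢
        linarith

end UpperBound

section RelativeEntropy

variable {X : Type*} [MeasurableSpace X] {R P : Measure X}

lemma absolutelyContinuous_and_integrable_of_klDiv_ne_top (h : klDiv R P ≠ ⊤) :
    R ≪ P ∧ Integrable (llr R P) R := by
  by_contra h'
  exact h (if_neg h')

lemma ofReal_integral_llr_le_klDiv : ENNReal.ofReal (∫ x, llr R P x ∂ R) ≤ klDiv R P := by
  rw [klDiv]
  split_ifs
  · exact le_rfl
  · exact le_top

end RelativeEntropy

/-- The quadratic-time MMD two-sample test `d_k(P̂_m, Q̂_n) ≤ γ_{m,n}` with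
`γ_{m,n} = (sqrt(K/m) + sqrt(K/n))(2 + sqrt(2 log(2/α)))`, for sample sizes
`m_k, n_k → ∞` with `m_k/(m_k+n_k) → c ∈ (0,1)`: under `H₀ : Q = P` it is level `α` for all
sample sizes, and under `H₁ : P ≠ Q` (with `0 < D* < ∞` where
`D* = inf_R [c D(R‖P) + (1-c) D(R‖Q)]`) its type-II error exponent in `m_k + n_k`
equals `D*`. -/
theorem mmd_two_sample_test_general_optimal {X : Type*} [MeasurableSpace X]
    [TopologicalSpace X] [PolishSpace X] [LocallyCompactSpace X] [T2Space X] [BorelSpace X]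
    [Nonempty X]
    (k : X → X → ℝ) (hk_cont : Continuous fun p : X × X => k p.1 p.2)
    (hk_symm : ∀ x y, k x y = k y x)
    (hk_psd : ∀ (N : ℕ) (z : Fin N → X) (c : Fin N → ℝ),
      0 ≤ ∑ i, ∑ j, c i * c j * k (z i) (z j))
    (K : ℝ) (hK : 0 < K) (hk_bdd : ∀ x y, k x y ∈ Set.Icc (0 : ℝ) K)
    (h_sep : ∀ R S : ProbabilityMeasure X,
      mmd k (R : Measure X) (S : Measure X) = 0 ↔ R = S)
    (h_tri : ∀ R S T : ProbabilityMeasure X,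
      mmd k (R : Measure X) (T : Measure X)
        ≤ mmd k (R : Measure X) (S : Measure X) + mmd k (S : Measure X) (T : Measure X))
    (h_metrize : ∀ s : Set (ProbabilityMeasure X),
      IsOpen s ↔ ∀ R ∈ s, ∃ ε > 0,
        ∀ S : ProbabilityMeasure X, mmd k (S : Measure X) (R : Measure X) < ε → S ∈ s)
    (P Q : ProbabilityMeasure X)
    (m n : ℕ → ℕ) (hm : Tendsto m atTop atTop) (hn : Tendsto n atTop atTop)
    (c : ℝ) (hc0 : 0 < c) (hc1 : c < 1)
    (hc : Tendsto (fun j : ℕ => (m j : ℝ) / (m j + n j)) atTop (𝓝 c))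
    (hD0 : 0 < ⨅ R : ProbabilityMeasure X,
      ENNReal.ofReal c * klDiv (R : Measure X) (P : Measure X)
        + ENNReal.ofReal (1 - c) * klDiv (R : Measure X) (Q : Measure X))
    (hD1 : (⨅ R : ProbabilityMeasure X,
      ENNReal.ofReal c * klDiv (R : Measure X) (P : Measure X)
        + ENNReal.ofReal (1 - c) * klDiv (R : Measure X) (Q : Measure X)) < ⊤)
    {α : ℝ} (hα0 : 0 < α) (hα1 : α < 1)
    (γ : ℕ → ℕ → ℝ)
    (hγ : ∀ m' n' : ℕ, γ m' n' = (Real.sqrt (K / m') + Real.sqrt (K / n')) *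
      (2 + Real.sqrt (2 * Real.log (2 / α)))) :
    (Q = P → ∀ m' n' : ℕ, 0 < m' → 0 < n' →
      (Measure.pi (fun _ : Fin m' => (P : Measure X))).prod
          (Measure.pi (fun _ : Fin n' => (P : Measure X)))
          {p : (Fin m' → X) × (Fin n' → X) |
            γ m' n' < mmd k (empMeas m' p.1 : Measure X) (empMeas n' p.2 : Measure X)}
        ≤ ENNReal.ofReal α)
    ∧ (P ≠ Q →
        liminf (fun j : ℕ => expRate (m j + n j)
            ((Measure.pi (fun _ : Fin (m j) => (P : Measure X))).prod
              (Measure.pi (fun _ : Fin (n j) => (Q : Measure X)))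
              {p : (Fin (m j) → X) × (Fin (n j) → X) |
                mmd k (empMeas (m j) p.1 : Measure X) (empMeas (n j) p.2 : Measure X)
                  ≤ γ (m j) (n j)})) atTop
          = ((⨅ R : ProbabilityMeasure X,
              ENNReal.ofReal c * klDiv (R : Measure X) (P : Measure X)
                + ENNReal.ofReal (1 - c) * klDiv (R : Measure X) (Q : Measure X) :
              ℝ≥0∞) : EReal)) := by
  have hk : Measurable fun p : X × X => k p.1 p.2 := hk_cont.measurable
  have h_self : ∀ R : ProbabilityMeasure X, mmd k (R : Measure X) (R : Measure X) = 0 :=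
    fun R => (h_sep R R).2 rfl
  refine ⟨fun _ m' n' hm' hn' => ?_, fun _ => ?_⟩
  · simp only [hγ]
    exact measure_mmd_empMeas_gt_le hk hk_symm hk_psd hK hk_bdd h_tri P hα0 hα1 hm' hn'
  have hγ0 : Tendsto (fun j => γ (m j) (n j)) atTop (𝓝 0) := by
    have hsqrt : ∀ l : ℕ → ℕ, Tendsto l atTop atTop →
        Tendsto (fun j => Real.sqrt (K / l j)) atTop (𝓝 0) := fun l hl => by
      simpa using ((tendsto_natCast_atTop_atTop (R := ℝ)).comp hl).const_div_atTop K |>.sqrt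
    simpa [hγ] using ((hsqrt m hm).add (hsqrt n hn)).mul_const
      (2 + Real.sqrt (2 * Real.log (2 / α)))
  set D := ⨅ R : ProbabilityMeasure X,
    ENNReal.ofReal c * klDiv (R : Measure X) (P : Measure X)
      + ENNReal.ofReal (1 - c) * klDiv (R : Measure X) (Q : Measure X) with hD
  have hDr : ENNReal.ofReal D.toReal = D := ENNReal.ofReal_toReal hD1.ne
  have hDpos : 0 < D.toReal := ENNReal.toReal_pos hD0.ne' hD1.ne
  have hDcoe : (D : EReal) = (D.toReal : EReal) := by
    rw [← EReal.coe_ennreal_toReal hD1.ne]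
  rw [hDcoe]
  refine le_antisymm (EReal.le_of_forall_lt_iff_le.1 fun b hb => ?_)
    (EReal.ge_of_forall_gt_iff_ge.1 fun a ha => ?_)
  · rw [EReal.coe_lt_coe_iff] at hb
    have hDb : D < ENNReal.ofReal b := by
      rwa [← hDr, ENNReal.ofReal_lt_ofReal_iff (hDpos.trans hb)]
    obtain ⟨R, hR⟩ := iInf_lt_iff.1 hDb
    obtain ⟨hRP, hP⟩ := absolutelyContinuous_and_integrable_of_klDiv_ne_top
      (R := (R : Measure X)) (P := P) fun h => by simp [h, hc0] at hR
    obtain ⟨hRQ, hQ⟩ := absolutelyContinuous_and_integrable_of_klDiv_ne_top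
      (R := (R : Measure X)) (P := Q) fun h => by simp [h, hc1] at hR
    have hllr : c * (∫ x, llr R P x ∂(R : Measure X)) + (1 - c) * (∫ x, llr R Q x ∂(R : Measure X))
        < b := by
      rw [← ENNReal.ofReal_lt_ofReal_iff (hDpos.trans hb)]
      refine (ENNReal.ofReal_add_le.trans ?_).trans_lt hR
      rw [ENNReal.ofReal_mul hc0.le, ENNReal.ofReal_mul (sub_nonneg.2 hc1.le)]
      gcongr <;> exact ofReal_integral_llr_le_klDiv
    have hmn := (hm.eventually_gt_atTop 0).and (hn.eventually_gt_atTop 0)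
    have hmeas : ∀ᶠ j in atTop, MeasurableSet {p : (Fin (m j) → X) × (Fin (n j) → X) |
        mmd k (empMeas (m j) p.1 : Measure X) (empMeas (n j) p.2 : Measure X) ≤ γ (m j) (n j)} :=
      hmn.mono fun j hj => measurableSet_le (measurable_mmd_empMeas hk hj.1 hj.2) measurable_const
    refine liminf_le_of_frequently_le' (Eventually.frequently (eventually_expRate_le hRP hRQ hP hQ
      hm hn hc hllr hmeas (sub_pos.2 hα1) ?_))
    filter_upwards [hmn, hmeas] with j hj hmj
    have hcompl := measure_mmd_empMeas_gt_le hk hk_symm hk_psd hK hk_bdd h_tri (R : Measure X) hα0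
      hα1 hj.1 hj.2
    rw [ENNReal.ofReal_sub _ hα0.le, ENNReal.ofReal_one, tsub_le_iff_right,
      ← prob_add_prob_compl (μ := (Measure.pi fun _ : Fin (m j) => (R : Measure X)).prod
        (Measure.pi fun _ : Fin (n j) => (R : Measure X))) hmj]
    refine add_le_add le_rfl ((measure_mono fun p hp => ?_).trans hcompl)
    rw [Set.mem_ofPred_eq, ← hγ]
    exact not_le.1 hp
  · rw [EReal.coe_lt_coe_iff] at ha
    refine le_liminf_of_le (by isBoundedDefault) ?_
    refine eventually_le_expRate hk hk_symm hk_bdd h_self h_tri h_metrize hm hn hc0 hc1 hc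
      (left_lt_add_div_two.2 ha) (fun R => lt_of_lt_of_le ?_ (hD ▸ iInf_le _ R : D ≤ _)) hγ0
    refine lt_of_lt_of_eq ?_ hDr
    rw [ENNReal.ofReal_lt_ofReal_iff hDpos]
    exact add_div_two_lt_right.2 ha
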